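/- arXiv:2407.03226 — 6 statements merged into one kernel-verified Lean document; each statement's English description precedes it below -/
import Mathlib

section
/- Let ξ be a real number such that 1, ξ, ξ², ξ³ are linearly independent over ℚ, and let c and λ be positive real numbers. Suppose that for every sufficiently large real number X there exists a non-zero point x = (x₀,x₁,x₂,x₃) ∈ ℤ⁴ with |x₀| ≤ X and max_{1≤i≤3} |x₀ξⁱ − x_i| ≤ cX^{−λ}. Then λ ≤ λ₃, and moreover if λ = λ₃ then c is bounded below by a positive constant depending only on ξ. -/
noncomputable section

/-- The golden ratio γ = (1+√5)/2. -/
def gold : ℝ := (1 + Real.sqrt 5) / 2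

/-- λ₃, the smallest positive root of T² − γ³T + γ. -/
def lambda3 : ℝ := (gold ^ 3 - Real.sqrt (gold ^ 6 - 4 * gold)) / 2

/-- The approximation hypothesis: for every sufficiently large real X there is a
nonzero integer point x ∈ ℤ⁴ with |x₀| ≤ X and max_{1≤i≤3} |x₀ξⁱ − x_i| ≤ c X^{−λ}. -/
def ApproxHyp (ξ c lam : ℝ) : Prop :=
  ∃ X₀ : ℝ, ∀ X : ℝ, X₀ ≤ X →
    ∃ x : Fin 4 → ℤ, x ≠ 0 ∧ |(x 0 : ℝ)| ≤ X ∧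
      ∀ i : Fin 4, 1 ≤ (i : ℕ) →
        |(x 0 : ℝ) * ξ ^ (i : ℕ) - (x i : ℝ)| ≤ c * X ^ (-lam)

/-! ### Linear algebra of integer points in dimension four -/

/-- The vector of signed `3 × 3` minors of `x, y, z`: it is orthogonal to `x`, `y` and `z`. -/
def cross (x y z : Fin 4 → ℤ) : Fin 4 → ℤ :=
  ![x 1 * (y 2 * z 3 - y 3 * z 2) - x 2 * (y 1 * z 3 - y 3 * z 1) + x 3 * (y 1 * z 2 - y 2 * z 1),
    -(x 0 * (y 2 * z 3 - y 3 * z 2) - x 2 * (y 0 * z 3 - y 3 * z 0)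
      + x 3 * (y 0 * z 2 - y 2 * z 0)),
    x 0 * (y 1 * z 3 - y 3 * z 1) - x 1 * (y 0 * z 3 - y 3 * z 0) + x 3 * (y 0 * z 1 - y 1 * z 0),
    -(x 0 * (y 1 * z 2 - y 2 * z 1) - x 1 * (y 0 * z 2 - y 2 * z 0)
      + x 2 * (y 0 * z 1 - y 1 * z 0))]

/-- Proportionality of integer points. -/
def Parallel {n : ℕ} (x y : Fin n → ℤ) : Prop := ∀ p q, x p * y q = x q * y p

lemma dot_four (R x : Fin 4 → ℤ) :
    R ⬝ᵥ x = R 0 * x 0 + R 1 * x 1 + R 2 * x 2 + R 3 * x 3 := by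
  simp [dotProduct, Fin.sum_univ_four]

lemma cross_dot_left (x y z : Fin 4 → ℤ) : cross x y z ⬝ᵥ x = 0 := by
  rw [dot_four]
  simp only [cross, Matrix.cons_val_zero, Matrix.cons_val_one, Matrix.cons_val]
  ring

lemma cross_dot_mid (x y z : Fin 4 → ℤ) : cross x y z ⬝ᵥ y = 0 := by
  rw [dot_four]
  simp only [cross, Matrix.cons_val_zero, Matrix.cons_val_one, Matrix.cons_val]
  ring

lemma cross_dot_right (x y z : Fin 4 → ℤ) : cross x y z ⬝ᵥ z = 0 := by
  rw [dot_four]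
  simp only [cross, Matrix.cons_val_zero, Matrix.cons_val_one, Matrix.cons_val]
  ring

lemma Parallel.symm {n : ℕ} {x y : Fin n → ℤ} (h : Parallel x y) : Parallel y x :=
  fun p q => by linear_combination -h p q

lemma Parallel.dot_eq_zero {c R w : Fin 4 → ℤ} (h : Parallel c R) (hR : R ≠ 0)
    (hw : R ⬝ᵥ w = 0) : c ⬝ᵥ w = 0 := by
  obtain ⟨p, hp⟩ := Function.ne_iff.1 hR
  refine (mul_eq_zero.1 (?_ : R p * (c ⬝ᵥ w) = 0)).resolve_left hp
  rw [dot_four] at *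
  linear_combination c p * hw - w 0 * h p 0 - w 1 * h p 1 - w 2 * h p 2 - w 3 * h p 3

lemma minors_eq_zero {x y z : Fin 4 → ℤ} (h : cross x y z = 0) (p q r : Fin 4) :
    x p * (y q * z r - y r * z q) - x q * (y p * z r - y r * z p)
      + x r * (y p * z q - y q * z p) = 0 := by
  have h0 := congrFun h 0
  have h1 := congrFun h 1
  have h2 := congrFun h 2
  have h3 := congrFun h 3
  simp [cross] at h0 h1 h2 h3
  fin_cases p <;> fin_cases q <;> fin_cases r <;> simp <;>
  first
  | ring1
  | linear_combination h0
  | linear_combination -h0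
  | linear_combination h1
  | linear_combination -h1
  | linear_combination h2
  | linear_combination -h2
  | linear_combination h3
  | linear_combination -h3

/-- A linear form vanishing on two independent points vanishes on the plane they span. -/
lemma dot_eq_zero_of_cross_eq_zero {x y z R : Fin 4 → ℤ} (hxy : ¬ Parallel x y)
    (hc : cross x y z = 0) (hx : R ⬝ᵥ x = 0) (hy : R ⬝ᵥ y = 0) : R ⬝ᵥ z = 0 := by
  simp only [Parallel, not_forall] at hxy
  obtain ⟨p, q, hpq⟩ := hxy
  have hm := minors_eq_zero hc p q
  refine (mul_eq_zero.1 (?_ : (x p * y q - x q * y p) * (R ⬝ᵥ z) = 0)).resolve_left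
    (sub_ne_zero.2 hpq)
  rw [dot_four] at *
  linear_combination (z p * y q - z q * y p) * hx + (x p * z q - x q * z p) * hy
    + R 0 * hm 0 + R 1 * hm 1 + R 2 * hm 2 + R 3 * hm 3

lemma cross_rotate {x y z : Fin 4 → ℤ} (h : cross x y z = 0) : cross y z x = 0 := by
  have h0 := congrFun h 0
  have h1 := congrFun h 1
  have h2 := congrFun h 2
  have h3 := congrFun h 3
  simp [cross] at h0 h1 h2 h3
  ext p
  fin_cases p <;> simp [cross]
  · linear_combination h0
  · linear_combination h1
  · linear_combination h2
  · linear_combination h3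

lemma parallel_cross {x y z R : Fin 4 → ℤ} (hx : R ⬝ᵥ x = 0) (hy : R ⬝ᵥ y = 0)
    (hz : R ⬝ᵥ z = 0) : Parallel (cross x y z) R := by
  rw [dot_four] at hx hy hz
  have key :
      cross x y z 0 * R 1 - cross x y z 1 * R 0 = 0 ∧
      cross x y z 0 * R 2 - cross x y z 2 * R 0 = 0 ∧
      cross x y z 0 * R 3 - cross x y z 3 * R 0 = 0 ∧
      cross x y z 1 * R 2 - cross x y z 2 * R 1 = 0 ∧
      cross x y z 1 * R 3 - cross x y z 3 * R 1 = 0 ∧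
      cross x y z 2 * R 3 - cross x y z 3 * R 2 = 0 := by
    simp only [cross, Matrix.cons_val_zero, Matrix.cons_val_one, Matrix.cons_val]
    refine ⟨?_, ?_, ?_, ?_, ?_, ?_⟩
    · linear_combination (y 2 * z 3 - y 3 * z 2) * hx - (x 2 * z 3 - x 3 * z 2) * hy
        + (x 2 * y 3 - x 3 * y 2) * hz
    · linear_combination -(y 1 * z 3 - y 3 * z 1) * hx + (x 1 * z 3 - x 3 * z 1) * hy
        - (x 1 * y 3 - x 3 * y 1) * hz
    · linear_combination (y 1 * z 2 - y 2 * z 1) * hx - (x 1 * z 2 - x 2 * z 1) * hy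
        + (x 1 * y 2 - x 2 * y 1) * hz
    · linear_combination (y 0 * z 3 - y 3 * z 0) * hx - (x 0 * z 3 - x 3 * z 0) * hy
        + (x 0 * y 3 - x 3 * y 0) * hz
    · linear_combination -(y 0 * z 2 - y 2 * z 0) * hx + (x 0 * z 2 - x 2 * z 0) * hy
        - (x 0 * y 2 - x 2 * y 0) * hz
    · linear_combination (y 0 * z 1 - y 1 * z 0) * hx - (x 0 * z 1 - x 1 * z 0) * hy
        + (x 0 * y 1 - x 1 * y 0) * hz
  obtain ⟨h01, h02, h03, h12, h13, h23⟩ := key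
  intro p q
  fin_cases p <;> fin_cases q <;> simp <;> linarith

/-- Two points lie in a common rational hyperplane. -/
lemma exists_ne_zero_dot_eq_zero {x y : Fin 4 → ℤ} (hxy : ¬ Parallel x y) :
    ∃ R : Fin 4 → ℤ, R ≠ 0 ∧ R ⬝ᵥ x = 0 ∧ R ⬝ᵥ y = 0 := by
  simp only [Parallel, not_forall] at hxy
  obtain ⟨p, q, hpq⟩ := hxy
  by_contra! h
  have key : ∀ w, cross x y w = 0 := fun w => by
    by_contra hw
    exact h _ hw (cross_dot_left x y w) (cross_dot_mid x y w)
  obtain ⟨r, hrp, hrq⟩ : ∃ r : Fin 4, r ≠ p ∧ r ≠ q :=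
    (by decide : ∀ p q : Fin 4, ∃ r, r ≠ p ∧ r ≠ q) p q
  have := minors_eq_zero (key (Pi.single r 1)) p q r
  simp [hrp.symm, hrq.symm] at this
  exact hpq (by linarith)

/-! ### Size estimates -/

/-- The error vector of the point `x` with respect to the line through `(1, ξ, ξ², ξ³)`. -/
def eps (ξ : ℝ) (x : Fin 4 → ℤ) : Fin 4 → ℝ := fun p => x 0 * ξ ^ (p : ℕ) - x p

/-- The largest error of the point `x`. -/
def err (ξ : ℝ) (x : Fin 4 → ℤ) : ℝ := ‖eps ξ x‖

/-- A common bound for `1, |ξ|, |ξ|², |ξ|³`. -/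
def powBound (ξ : ℝ) : ℝ := 1 + |ξ| + |ξ| ^ 2 + |ξ| ^ 3

lemma one_le_powBound (ξ : ℝ) : 1 ≤ powBound ξ := by
  unfold powBound
  have := abs_nonneg ξ
  have := pow_nonneg this 3
  nlinarith [sq_nonneg |ξ|]

lemma abs_pow_le_powBound (ξ : ℝ) (p : Fin 4) : |ξ ^ (p : ℕ)| ≤ powBound ξ := by
  unfold powBound
  have h1 := abs_nonneg ξ
  have h2 := pow_nonneg h1 2
  have h3 := pow_nonneg h1 3
  rw [abs_pow]
  have h4 := sq_nonneg ξ
  fin_cases p <;> norm_num <;> linarith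

lemma abs_eps_le (ξ : ℝ) (x : Fin 4 → ℤ) (p : Fin 4) : |eps ξ x p| ≤ err ξ x :=
  norm_le_pi_norm (eps ξ x) p

lemma err_nonneg (ξ : ℝ) (x : Fin 4 → ℤ) : 0 ≤ err ξ x := norm_nonneg _

lemma coord_eq (ξ : ℝ) (x : Fin 4 → ℤ) (p : Fin 4) :
    (x p : ℝ) = x 0 * ξ ^ (p : ℕ) - eps ξ x p := by simp [eps]

lemma abs_mul_le_mul {a b A B : ℝ} (ha : |a| ≤ A) (hb : |b| ≤ B) : |a * b| ≤ A * B := by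
  rw [abs_mul]
  exact mul_le_mul ha hb (abs_nonneg _) ((abs_nonneg _).trans ha)

lemma abs_mul_mul_le {a b c A B C : ℝ} (ha : |a| ≤ A) (hb : |b| ≤ B) (hc : |c| ≤ C) :
    |a * b * c| ≤ A * B * C := abs_mul_le_mul (abs_mul_le_mul ha hb) hc

lemma abs_det_le {u₁ u₂ u₃ v₁ v₂ v₃ w₁ w₂ w₃ Z A B : ℝ} (hu₁ : |u₁| ≤ Z) (hu₂ : |u₂| ≤ Z)
    (hu₃ : |u₃| ≤ Z) (hv₁ : |v₁| ≤ A) (hw₁ : |w₁| ≤ A) (hv₂ : |v₂| ≤ B) (hw₂ : |w₂| ≤ B)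
    (hv₃ : |v₃| ≤ B) (hw₃ : |w₃| ≤ B) (hBA : B ≤ A) :
    |u₁ * (v₂ * w₃ - v₃ * w₂) - u₂ * (v₁ * w₃ - v₃ * w₁) + u₃ * (v₁ * w₂ - v₂ * w₁)|
      ≤ 6 * (Z * A * B) := by
  have h1 := abs_le.1 (abs_mul_mul_le hu₁ (hv₂.trans hBA) hw₃)
  have h2 := abs_le.1 (abs_mul_mul_le hu₁ (hw₂.trans hBA) hv₃)
  have h3 := abs_le.1 (abs_mul_mul_le hu₂ hv₁ hw₃)
  have h4 := abs_le.1 (abs_mul_mul_le hu₂ hw₁ hv₃)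
  have h5 := abs_le.1 (abs_mul_mul_le hu₃ hv₁ hw₂)
  have h6 := abs_le.1 (abs_mul_mul_le hu₃ hw₁ hv₂)
  rw [abs_le]
  constructor <;> linarith

/-- The `3 × 3` minors of three points of increasing size and decreasing error. -/
lemma abs_minor_le {ξ : ℝ} {x y z : Fin 4 → ℤ} {Z A B : ℝ}
    (hx : |(x 0 : ℝ)| ≤ Z) (hy : |(y 0 : ℝ)| ≤ Z) (hz : |(z 0 : ℝ)| ≤ Z) (hZ : 1 ≤ Z)
    (hxA : err ξ x ≤ A) (hyB : err ξ y ≤ B) (hzB : err ξ z ≤ B) (hBA : B ≤ A) (hA : A ≤ 1)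
    (a b c : Fin 4) :
    |((x a * (y b * z c - y c * z b) - x b * (y a * z c - y c * z a)
      + x c * (y a * z b - y b * z a) : ℤ) : ℝ)| ≤ 24 * powBound ξ * (Z * A * B) := by
  have ex := fun p => (abs_eps_le ξ x p).trans hxA
  have ey := fun p => (abs_eps_le ξ y p).trans hyB
  have ez := fun p => (abs_eps_le ξ z p).trans hzB
  have hA0 : 0 ≤ A := (err_nonneg ξ x).trans hxA
  have hB0 : 0 ≤ B := (err_nonneg ξ y).trans hyB
  have h1 := abs_mul_le_mul (abs_pow_le_powBound ξ a)
    (abs_det_le hx hy hz (ex b) (ex c) (ey b) (ey c) (ez b) (ez c) hBA)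
  have h2 := abs_mul_le_mul (abs_pow_le_powBound ξ b)
    (abs_det_le hx hy hz (ex a) (ex c) (ey a) (ey c) (ez a) (ez c) hBA)
  have h3 := abs_mul_le_mul (abs_pow_le_powBound ξ c)
    (abs_det_le hx hy hz (ex a) (ex b) (ey a) (ey b) (ez a) (ez b) hBA)
  have h4 := abs_det_le (((ex a).trans hA).trans hZ) (((ey a).trans (hBA.trans hA)).trans hZ)
    (((ez a).trans (hBA.trans hA)).trans hZ) (ex b) (ex c) (ey b) (ey c) (ez b) (ez c) hBA
  have h5 : Z * A * B ≤ powBound ξ * (Z * A * B) :=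
    le_mul_of_one_le_left (by positivity) (one_le_powBound ξ)
  push_cast
  rw [coord_eq ξ x a, coord_eq ξ x b, coord_eq ξ x c, coord_eq ξ y a, coord_eq ξ y b,
    coord_eq ξ y c, coord_eq ξ z a, coord_eq ξ z b, coord_eq ξ z c]
  rw [abs_le] at *
  constructor <;> linarith

lemma norm_cross_le {ξ : ℝ} {x y z : Fin 4 → ℤ} {Z A B : ℝ}
    (hx : |(x 0 : ℝ)| ≤ Z) (hy : |(y 0 : ℝ)| ≤ Z) (hz : |(z 0 : ℝ)| ≤ Z) (hZ : 1 ≤ Z)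
    (hxA : err ξ x ≤ A) (hyB : err ξ y ≤ B) (hzB : err ξ z ≤ B) (hBA : B ≤ A) (hA : A ≤ 1) :
    ‖cross x y z‖ ≤ 24 * powBound ξ * (Z * A * B) := by
  have key := abs_minor_le hx hy hz hZ hxA hyB hzB hBA hA
  have h0 := key 1 2 3
  have h1 := key 0 2 3
  have h2 := key 0 1 3
  have h3 := key 0 1 2
  refine (pi_norm_le_iff_of_nonneg ((abs_nonneg _).trans h0)).2 fun p => ?_
  rw [Int.norm_eq_abs]
  fin_cases p
  · exact h0
  · rw [← abs_neg, ← Int.cast_neg] at h1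
    exact h1
  · exact h2
  · rw [← abs_neg, ← Int.cast_neg] at h3
    exact h3

lemma abs_coord_le_norm {n : ℕ} (R : Fin n → ℤ) (p : Fin n) : |(R p : ℝ)| ≤ ‖R‖ := by
  rw [← Int.norm_eq_abs]
  exact norm_le_pi_norm R p

/-- A linear form vanishing at `y` takes controlled values. -/
lemma abs_dot_mul_le {ξ : ℝ} {R y z : Fin 4 → ℤ} (h : R ⬝ᵥ y = 0) :
    |((R ⬝ᵥ z : ℤ) : ℝ)| * |(y 0 : ℝ)|
      ≤ 4 * ‖R‖ * (|(z 0 : ℝ)| * err ξ y + |(y 0 : ℝ)| * err ξ z) := by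
  have hR := abs_coord_le_norm R
  have h' : (R 0 * y 0 + R 1 * y 1 + R 2 * y 2 + R 3 * y 3 : ℝ) = 0 := by
    rw [dot_four] at h; exact_mod_cast h
  have k1 := fun p => abs_mul_mul_le (hR p) (le_refl |(z 0 : ℝ)|) (abs_eps_le ξ y p)
  have k2 := fun p => abs_mul_mul_le (hR p) (le_refl |(y 0 : ℝ)|) (abs_eps_le ξ z p)
  have key : ((R ⬝ᵥ z : ℤ) : ℝ) * y 0 = (R 0 * z 0 * eps ξ y 0 - R 0 * y 0 * eps ξ z 0)
      + (R 1 * z 0 * eps ξ y 1 - R 1 * y 0 * eps ξ z 1)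
      + (R 2 * z 0 * eps ξ y 2 - R 2 * y 0 * eps ξ z 2)
      + (R 3 * z 0 * eps ξ y 3 - R 3 * y 0 * eps ξ z 3) := by
    rw [dot_four]
    push_cast
    simp only [eps]
    linear_combination (z 0 : ℝ) * h'
  rw [← abs_mul, key]
  have a0 := abs_le.1 (k1 0)
  have a1 := abs_le.1 (k1 1)
  have a2 := abs_le.1 (k1 2)
  have a3 := abs_le.1 (k1 3)
  have b0 := abs_le.1 (k2 0)
  have b1 := abs_le.1 (k2 1)
  have b2 := abs_le.1 (k2 2)
  have b3 := abs_le.1 (k2 3)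
  rw [abs_le]
  constructor <;> linarith

/-- The coefficients of the Hessian covariant of `x`, regarded as a binary cubic form. -/
def hess (x : Fin 4 → ℤ) : Fin 3 → ℤ :=
  ![x 1 * x 3 - x 2 ^ 2, x 1 * x 2 - x 0 * x 3, x 0 * x 2 - x 1 ^ 2]

/-- The contraction of a quadratic form with a cubic form. -/
def contract (q : Fin 3 → ℤ) (z : Fin 4 → ℤ) : Fin 2 → ℤ :=
  ![q 0 * z 0 + q 1 * z 1 + q 2 * z 2, q 0 * z 1 + q 1 * z 2 + q 2 * z 3]

/-- The contraction of the Hessian covariant of `x` with `z`. -/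
def pairing (x z : Fin 4 → ℤ) : Fin 2 → ℤ := contract (hess x) z

section Hessian

variable {ξ : ℝ} {x z : Fin 4 → ℤ} {X A : ℝ}

lemma abs_hess_le (hX : |(x 0 : ℝ)| ≤ X) (hX1 : 1 ≤ X) (hA : err ξ x ≤ A) (hA1 : A ≤ 1)
    (p : Fin 3) : |(hess x p : ℝ)| ≤ 6 * powBound ξ * (X * A) := by
  have e := fun p => (abs_eps_le ξ x p).trans hA
  have hA0 : 0 ≤ A := (err_nonneg ξ x).trans hA
  have c1 := fun p q => abs_le.1 (abs_mul_mul_le (abs_pow_le_powBound ξ p) hX (e q))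
  have c2 := fun p q => abs_le.1 (abs_mul_le_mul ((e p).trans (hA1.trans hX1)) (e q))
  have hM : X * A ≤ powBound ξ * X * A := by
    rw [mul_assoc]
    exact le_mul_of_one_le_left (by positivity) (one_le_powBound ξ)
  have x1 := coord_eq ξ x 1
  have x2 := coord_eq ξ x 2
  have x3 := coord_eq ξ x 3
  have a00 := c1 0 0
  have a01 := c1 0 1
  have a02 := c1 0 2
  have a03 := c1 0 3
  have a11 := c1 1 1
  have a12 := c1 1 2
  have a13 := c1 1 3
  have a21 := c1 2 1
  have a22 := c1 2 2
  have a31 := c1 3 1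
  have b13 := c2 1 3
  have b22 := c2 2 2
  have b12 := c2 1 2
  have b11 := c2 1 1
  simp only [Fin.val_zero, Fin.val_one, Fin.val_two,
    show ((3 : Fin 4) : ℕ) = 3 from rfl, pow_zero, pow_one] at *
  fin_cases p <;> simp [hess] <;> rw [x1, x2] <;> try rw [x3]
  all_goals
    rw [abs_le]
    constructor <;> linarith

lemma abs_hess_eval_le (hA : err ξ x ≤ A) :
    |(hess x 0 : ℝ) + hess x 1 * ξ + hess x 2 * ξ ^ 2| ≤ 4 * powBound ξ * A ^ 2 := by
  have e := fun p => (abs_eps_le ξ x p).trans hA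
  have hA0 : 0 ≤ A := (err_nonneg ξ x).trans hA
  have c := fun r p q => abs_le.1 (abs_mul_mul_le (abs_pow_le_powBound ξ r) (e p) (e q))
  have key : (hess x 0 : ℝ) + hess x 1 * ξ + hess x 2 * ξ ^ 2
      = ξ ^ 0 * eps ξ x 1 * eps ξ x 3 - ξ ^ 0 * eps ξ x 2 * eps ξ x 2
        + ξ ^ 1 * eps ξ x 1 * eps ξ x 2 - ξ ^ 2 * eps ξ x 1 * eps ξ x 1 := by
    simp [hess, eps]
    ring
  have c1 := c 0 1 3
  have c2 := c 0 2 2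
  have c3 := c 1 1 2
  have c4 := c 2 1 1
  simp only [Fin.val_zero, Fin.val_one, Fin.val_two] at *
  rw [key, abs_le]
  constructor <;> nlinarith

variable {Z B : ℝ}

lemma norm_pairing_le (hX : |(x 0 : ℝ)| ≤ X) (hX1 : 1 ≤ X) (hA : err ξ x ≤ A) (hA1 : A ≤ 1)
    (hZ : |(z 0 : ℝ)| ≤ Z) (hB : err ξ z ≤ B) :
    ‖pairing x z‖ ≤ 18 * powBound ξ ^ 2 * (Z * A ^ 2 + X * A * B) := by
  have hA0 : 0 ≤ A := (err_nonneg ξ x).trans hA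
  have hB0 : 0 ≤ B := (err_nonneg ξ z).trans hB
  have hZ0 : 0 ≤ Z := (abs_nonneg _).trans hZ
  have f := fun p => (abs_eps_le ξ z p).trans hB
  have M1 := one_le_powBound ξ
  have c := fun p q => abs_le.1 (abs_mul_le_mul (abs_hess_le hX hX1 hA hA1 p) (f q))
  have d := fun r => abs_le.1
    (abs_mul_mul_le (abs_pow_le_powBound ξ r) hZ (abs_hess_eval_le hA))
  have hMM : powBound ξ ≤ powBound ξ ^ 2 := by nlinarith
  have g1 : powBound ξ * (Z * A ^ 2) ≤ powBound ξ ^ 2 * (Z * A ^ 2) :=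
    mul_le_mul_of_nonneg_right hMM (by positivity)
  have g2 : powBound ξ * (X * A * B) ≤ powBound ξ ^ 2 * (X * A * B) :=
    mul_le_mul_of_nonneg_right hMM (by positivity)
  have g3 : 0 ≤ powBound ξ ^ 2 * (Z * A ^ 2) := by positivity
  have g4 : 0 ≤ powBound ξ * (X * A * B) := by positivity
  have z1 := coord_eq ξ z 1
  have z2 := coord_eq ξ z 2
  have z3 := coord_eq ξ z 3
  refine (pi_norm_le_iff_of_nonneg (by positivity)).2 fun p => ?_
  rw [Int.norm_eq_abs]
  have d0 := d 0
  have d1 := d 1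
  have c11 := c 1 1
  have c22 := c 2 2
  have c01 := c 0 1
  have c12 := c 1 2
  have c23 := c 2 3
  simp only [Fin.val_zero, Fin.val_one, Fin.val_two,
    show ((3 : Fin 4) : ℕ) = 3 from rfl, pow_zero, pow_one] at *
  fin_cases p <;> simp [pairing, contract] <;> rw [z1, z2] <;> try rw [z3]
  all_goals
    rw [abs_le]
    constructor <;> linarith

lemma abs_pairing_eval_le (hX : |(x 0 : ℝ)| ≤ X) (hX1 : 1 ≤ X) (hA : err ξ x ≤ A)
    (hA1 : A ≤ 1) (hB : err ξ z ≤ B) :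
    |ξ * pairing x z 0 - pairing x z 1| ≤ 30 * powBound ξ ^ 2 * (X * A * B) := by
  have hA0 : 0 ≤ A := (err_nonneg ξ x).trans hA
  have hB0 : 0 ≤ B := (err_nonneg ξ z).trans hB
  have f := fun p => (abs_eps_le ξ z p).trans hB
  have M1 := one_le_powBound ξ
  have c := fun p q => abs_mul_le_mul (abs_hess_le hX hX1 hA hA1 p) (f q)
  have d := fun r p q => abs_le.1 (abs_mul_le_mul (abs_pow_le_powBound ξ r) (c p q))
  have key : ξ * pairing x z 0 - pairing x z 1
      = ξ ^ 0 * (hess x 0 * eps ξ z 1) + ξ ^ 0 * (hess x 1 * eps ξ z 2)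
        + ξ ^ 0 * (hess x 2 * eps ξ z 3) - ξ ^ 1 * (hess x 1 * eps ξ z 1)
        - ξ ^ 1 * (hess x 2 * eps ξ z 2) := by
    simp [pairing, contract, eps]
    ring
  have d1 := d 0 0 1
  have d2 := d 0 1 2
  have d3 := d 0 2 3
  have d4 := d 1 1 1
  have d5 := d 1 2 2
  simp only [Fin.val_zero, Fin.val_one] at *
  rw [key, abs_le]
  constructor <;> linarith

end Hessian

/-! ### Minimal points -/

section MinimalPoints

variable {ξ c lam : ℝ}

lemma form_ne_zero (hξ : LinearIndependent ℚ ![(1 : ℝ), ξ, ξ ^ 2, ξ ^ 3]) {R : Fin 4 → ℤ}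
    (hR : R ≠ 0) : (R 0 + R 1 * ξ + R 2 * ξ ^ 2 + R 3 * ξ ^ 3 : ℝ) ≠ 0 := by
  intro h
  refine hR (funext fun p => ?_)
  have := Fintype.linearIndependent_iff.1 hξ (fun p => (R p : ℚ)) (by
    simp [Fin.sum_univ_four, Algebra.smul_def]
    linarith) p
  exact_mod_cast this

lemma err_pos (hξ : LinearIndependent ℚ ![(1 : ℝ), ξ, ξ ^ 2, ξ ^ 3]) {x : Fin 4 → ℤ}
    (hx : x ≠ 0) : 0 < err ξ x := by
  refine (err_nonneg ξ x).lt_of_ne fun h => hx ?_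
  have he : ∀ p, (x p : ℝ) = x 0 * ξ ^ (p : ℕ) := fun p => by
    have h1 := abs_eps_le ξ x p
    rw [← h] at h1
    have h2 := abs_nonpos_iff.1 h1
    have h3 := coord_eq ξ x p
    rw [h2] at h3
    linarith
  have h0 : x 0 = 0 := by
    by_contra h0
    refine form_ne_zero hξ (R := ![x 1, -x 0, 0, 0]) (fun h => h0 ?_) ?_
    · simpa using congrFun h 1
    · simp [he 1]
  funext p
  have := he p
  rw [h0] at this
  simpa using this

lemma ApproxHyp.exists_err_le (h : ApproxHyp ξ c lam) (hc : 0 ≤ c) :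
    ∃ X₀ : ℝ, 0 < X₀ ∧ ∀ X, X₀ ≤ X →
      ∃ x : Fin 4 → ℤ, x ≠ 0 ∧ |(x 0 : ℝ)| ≤ X ∧ err ξ x ≤ c * X ^ (-lam) := by
  obtain ⟨X₀, h⟩ := h
  refine ⟨max X₀ 1, by positivity, fun X hX => ?_⟩
  obtain ⟨x, hx, hxX, he⟩ := h X ((le_max_left _ _).trans hX)
  have hX0 : 0 ≤ X := zero_le_one.trans ((le_max_right _ _).trans hX)
  refine ⟨x, hx, hxX, (pi_norm_le_iff_of_nonneg (by positivity)).2 fun p => ?_⟩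
  by_cases hp : 1 ≤ (p : ℕ)
  · exact he p hp
  · obtain rfl : p = 0 := Fin.ext (by simpa using hp)
    simp only [eps, Fin.val_zero, pow_zero, mul_one, sub_self, norm_zero]
    positivity

lemma ApproxHyp.exists_err_lt (h : ApproxHyp ξ c lam) (hc : 0 ≤ c) (hlam : 0 < lam) {δ : ℝ}
    (hδ : 0 < δ) : ∃ x : Fin 4 → ℤ, x ≠ 0 ∧ err ξ x < δ := by
  obtain ⟨X₀, -, h⟩ := h.exists_err_le hc
  have ht : Filter.Tendsto (fun X : ℝ => c * X ^ (-lam)) Filter.atTop (nhds 0) := by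
    simpa using (tendsto_rpow_neg_atTop hlam).const_mul c
  obtain ⟨X, hXδ, hX⟩ := ((ht.eventually_lt_const hδ).and (Filter.eventually_ge_atTop X₀)).exists
  obtain ⟨x, hx, -, he⟩ := h X hX
  exact ⟨x, hx, he.trans_lt hXδ⟩

lemma finite_points (ξ X δ : ℝ) :
    {x : Fin 4 → ℤ | |(x 0 : ℝ)| ≤ X ∧ err ξ x ≤ δ}.Finite := by
  obtain ⟨N, hN⟩ := exists_nat_ge (X * powBound ξ + δ)
  refine (Set.finite_Icc (fun _ : Fin 4 => -(N : ℤ)) fun _ => (N : ℤ)).subset ?_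
  rintro x ⟨hX, hδ⟩
  have key : ∀ p, |x p| ≤ (N : ℤ) := fun p => by
    have h1 := abs_le.1 (abs_mul_le_mul hX (abs_pow_le_powBound ξ p))
    have h2 := abs_le.1 ((abs_eps_le ξ x p).trans hδ)
    have h3 : |(x p : ℝ)| ≤ N := by
      rw [coord_eq ξ x p, abs_le]
      constructor <;> linarith
    exact_mod_cast h3
  exact ⟨fun p => (abs_le.1 (key p)).1, fun p => (abs_le.1 (key p)).2⟩

/-- The minimal point following `x`. -/
lemma exists_next (hsmall : ∀ δ > 0, ∃ z : Fin 4 → ℤ, z ≠ 0 ∧ err ξ z < δ) {x : Fin 4 → ℤ}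
    (hx : 0 < err ξ x) :
    ∃ y : Fin 4 → ℤ, y ≠ 0 ∧ err ξ y < err ξ x ∧
      (∀ z : Fin 4 → ℤ, z ≠ 0 → err ξ z < err ξ x → |(y 0 : ℝ)| ≤ |(z 0 : ℝ)|) ∧
      ∀ z : Fin 4 → ℤ, z ≠ 0 → |(z 0 : ℝ)| ≤ |(y 0 : ℝ)| → err ξ y ≤ err ξ z := by
  classical
  have hex : ∃ n : ℕ, ∃ z : Fin 4 → ℤ, z ≠ 0 ∧ err ξ z < err ξ x ∧ (z 0).natAbs = n := by
    obtain ⟨z, hz, h⟩ := hsmall _ hx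
    exact ⟨_, z, hz, h, rfl⟩
  have habs : ∀ z : Fin 4 → ℤ, |(z 0 : ℝ)| = ((z 0).natAbs : ℝ) := fun z => by
    rw [Nat.cast_natAbs, Int.cast_abs]
  obtain ⟨z, hz, hzx, hzn⟩ := Nat.find_spec hex
  set n := Nat.find hex with hn
  have hmin : ∀ w : Fin 4 → ℤ, w ≠ 0 → err ξ w < err ξ x → n ≤ (w 0).natAbs :=
    fun w hw h => Nat.find_min' hex ⟨w, hw, h, rfl⟩
  obtain ⟨y, ⟨hy, hyn, hyx⟩, hymin⟩ := Set.exists_min_image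
    {w : Fin 4 → ℤ | w ≠ 0 ∧ |(w 0 : ℝ)| ≤ n ∧ err ξ w < err ξ x} (err ξ)
    ((finite_points ξ n (err ξ x)).subset fun w hw => ⟨hw.2.1, hw.2.2.le⟩)
    ⟨z, hz, by rw [habs, hzn], hzx⟩
  refine ⟨y, hy, hyx, fun w hw h => ?_, fun w hw h => ?_⟩
  · refine hyn.trans ?_
    rw [habs]
    exact_mod_cast hmin w hw h
  · by_cases hwx : err ξ w < err ξ x
    · exact hymin w ⟨hw, h.trans hyn, hwx⟩
    · exact hyx.le.trans (not_lt.1 hwx)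

/-- A sequence of integer points with increasing first coordinates, in absolute value `exp t`, and
decreasing errors `exp (-l)`, such that the approximation exponent is at least `lam`. The number `k`
is large enough to absorb the constants of all the size estimates. -/
structure PointSeq (ξ lam k : ℝ) where
  indep : LinearIndependent ℚ ![(1 : ℝ), ξ, ξ ^ 2, ξ ^ 3]
  le_lam : 0.4245 ≤ lam
  lam_lt : lam < 1 / 2
  le_exp : 1000 * powBound ξ ^ 2 ≤ Real.exp k
  x : ℕ → Fin 4 → ℤ
  t : ℕ → ℝ
  l : ℕ → ℝ
  abs_eq : ∀ i, |(x i 0 : ℝ)| = Real.exp (t i)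
  err_eq : ∀ i, err ξ (x i) = Real.exp (-l i)
  t_nonneg : ∀ i, 0 ≤ t i
  t_strictMono : StrictMono t
  l_strictMono : StrictMono l
  le_l : ∀ i, lam * t (i + 1) + 3 * k ≤ l i

lemma exists_minimal_points (hξ : LinearIndependent ℚ ![(1 : ℝ), ξ, ξ ^ 2, ξ ^ 3])
    (hsmall : ∀ δ > 0, ∃ z : Fin 4 → ℤ, z ≠ 0 ∧ err ξ z < δ) :
    ∃ x : ℕ → Fin 4 → ℤ, (∀ i, x i ≠ 0) ∧ (∀ i : ℕ, (i : ℝ) ≤ |(x i 0 : ℝ)|) ∧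
      StrictMono (fun i => |(x i 0 : ℝ)|) ∧ StrictAnti (fun i => err ξ (x i)) ∧
      ∀ i, ∀ z : Fin 4 → ℤ, z ≠ 0 → |(z 0 : ℝ)| < |(x (i + 1) 0 : ℝ)| →
        err ξ (x i) ≤ err ξ z := by
  choose! next h_ne h_err h_size h_min using fun (x : Fin 4 → ℤ) (hx : x ≠ 0) =>
    exists_next hsmall (err_pos hξ hx)
  let y : ℕ → Fin 4 → ℤ := fun i => next^[i] (fun _ => 1)
  have hy : ∀ i, y (i + 1) = next (y i) := fun i => Function.iterate_succ_apply' next i _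
  have hy0 : ∀ i, y i ≠ 0 := fun i => by
    induction i with
    | zero => exact fun h => by simpa [y] using congrFun h 0
    | succ i ih => rw [hy]; exact h_ne _ ih
  have herr : ∀ i, err ξ (y (i + 1)) < err ξ (y i) := fun i => by
    rw [hy]; exact h_err _ (hy0 i)
  have hlt : ∀ i, |y (i + 1) 0| < |y (i + 1 + 1) 0| := fun i => by
    by_contra! h
    have h1 := h_min (y i) (hy0 i) (y (i + 1 + 1)) (hy0 _) (by
      rw [← hy]
      exact_mod_cast h)
    rw [← hy] at h1
    exact absurd (herr (i + 1)) (not_lt.2 h1)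
  refine ⟨fun i => y (i + 1), fun i => hy0 _, fun i => ?_, strictMono_nat_of_lt_succ fun i => ?_,
    strictAnti_nat_of_succ_lt fun i => herr _, fun i z hz h => ?_⟩
  · have : (i : ℤ) ≤ |y (i + 1) 0| := by
      induction i with
      | zero => simp
      | succ i ih =>
        have := hlt i
        push_cast
        omega
    exact_mod_cast this
  · exact_mod_cast hlt i
  · by_contra! hc
    have := h_size _ (hy0 (i + 1)) z hz hc
    rw [← hy] at this
    exact absurd h (not_lt.2 this)

lemma exists_pointSeq (hξ : LinearIndependent ℚ ![(1 : ℝ), ξ, ξ ^ 2, ξ ^ 3]) 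
    (le_lam : 0.4245 ≤ lam) (lam_lt : lam < 1 / 2) (hc : 0 < c) {k : ℝ}
    (le_exp : 1000 * powBound ξ ^ 2 ≤ Real.exp k) (hck : 2 * c ≤ Real.exp (-(3 * k)))
    (h : ApproxHyp ξ c lam) : Nonempty (PointSeq ξ lam k) := by
  have hlam : 0 < lam := by linarith
  obtain ⟨x, hx0, hxi, hmono, hanti, hmin⟩ :=
    exists_minimal_points hξ fun δ hδ => h.exists_err_lt hc.le hlam hδ
  obtain ⟨X₀, hX₀, happ⟩ := h.exists_err_le hc.le
  obtain ⟨n, hn⟩ := exists_nat_ge (max 1 (2 * X₀))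
  have hn' : ∀ i, max 1 (2 * X₀) ≤ |(x (i + n) 0 : ℝ)| := fun i =>
    (hn.trans (by exact_mod_cast Nat.le_add_left n i)).trans (hxi (i + n))
  have hpos : ∀ i, 0 < |(x (i + n) 0 : ℝ)| := fun i =>
    zero_lt_one.trans_le ((le_max_left _ _).trans (hn' i))
  refine ⟨⟨hξ, le_lam, lam_lt, le_exp, fun i => x (i + n), fun i => Real.log |(x (i + n) 0 : ℝ)|,
    fun i => -Real.log (err ξ (x (i + n))), fun i => (Real.exp_log (hpos i)).symm,
    fun i => ?_, fun i => Real.log_nonneg ((le_max_left _ _).trans (hn' i)),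
    fun i j hij => Real.log_lt_log (hpos i) (hmono (by omega)), fun i j hij => neg_lt_neg
      (Real.log_lt_log (err_pos hξ (hx0 _)) (hanti (by omega))), fun i => ?_⟩⟩
  · rw [neg_neg, Real.exp_log (err_pos hξ (hx0 _))]
  · have hX := hn' (i + 1)
    have hXp := hpos (i + 1)
    rw [add_right_comm] at hX hXp
    rw [add_right_comm i 1 n]
    set X := |(x (i + n + 1) 0 : ℝ)| with hXdef
    obtain ⟨z, hz, hzX, hze⟩ := happ (X / 2) (by linarith [le_max_right 1 (2 * X₀)])
    have h1 := hmin (i + n) z hz (hzX.trans_lt (by linarith))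
    have h2 := (Real.log_le_log (err_pos hξ (hx0 _)) (h1.trans hze))
    rw [Real.log_mul hc.ne' (by positivity), Real.log_rpow (by positivity),
      Real.log_div hXp.ne' two_ne_zero] at h2
    have h3 := (Real.log_le_iff_le_exp (by positivity)).2 hck
    rw [Real.log_mul two_ne_zero hc.ne'] at h3
    nlinarith [Real.log_pos one_lt_two]

end MinimalPoints

/-! ### Basic properties of sequences of points -/

lemma one_le_norm {n : ℕ} {v : Fin n → ℤ} (hv : v ≠ 0) : 1 ≤ ‖v‖ := by
  obtain ⟨p, hp⟩ := Function.ne_iff.1 hv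
  refine le_trans ?_ (norm_le_pi_norm v p)
  rw [Int.norm_eq_abs]
  exact_mod_cast Int.one_le_abs hp

lemma nonneg_of_one_le_mul_exp {C a b : ℝ} (h : 1 ≤ C * Real.exp a) (hC : C ≤ Real.exp b) :
    0 ≤ a + b := by
  rw [← Real.one_le_exp_iff, Real.exp_add, mul_comm]
  exact h.trans (mul_le_mul_of_nonneg_right hC (Real.exp_pos a).le)

namespace PointSeq

variable {ξ lam k : ℝ} (S : PointSeq ξ lam k)

/-- The sequence without its first `n` points. -/
def shift (n : ℕ) : PointSeq ξ lam k where
  indep := S.indep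
  le_lam := S.le_lam
  lam_lt := S.lam_lt
  le_exp := S.le_exp
  x i := S.x (i + n)
  t i := S.t (i + n)
  l i := S.l (i + n)
  abs_eq i := S.abs_eq (i + n)
  err_eq i := S.err_eq (i + n)
  t_nonneg i := S.t_nonneg (i + n)
  t_strictMono := S.t_strictMono.comp fun _ _ h => by simpa using h
  l_strictMono := S.l_strictMono.comp fun _ _ h => by simpa using h
  le_l i := by simpa only [add_right_comm i 1 n] using S.le_l (i + n)

lemma x_zero_ne_zero (i : ℕ) : S.x i 0 ≠ 0 := fun h => by
  have := S.abs_eq i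
  rw [h, Int.cast_zero, abs_zero] at this
  exact (Real.exp_pos _).ne this

lemma k_pos (S : PointSeq ξ lam k) : 0 < k := by
  rw [← Real.one_lt_exp_iff]
  nlinarith [S.le_exp, one_le_powBound ξ]

lemma t_lt {i j : ℕ} (h : i < j) : S.t i < S.t j := S.t_strictMono h

lemma t_le {i j : ℕ} (h : i ≤ j) : S.t i ≤ S.t j := S.t_strictMono.monotone h

lemma l_le {i j : ℕ} (h : i ≤ j) : S.l i ≤ S.l j := S.l_strictMono.monotone h

lemma lam_mul_t_nonneg (i : ℕ) : 0 ≤ lam * S.t i :=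
  mul_nonneg (by linarith [S.le_lam]) (S.t_nonneg i)

lemma l_nonneg (i : ℕ) : 0 ≤ S.l i := by
  linarith [S.le_l i, S.k_pos, S.lam_mul_t_nonneg (i + 1)]

lemma one_le_exp_t (i : ℕ) : 1 ≤ Real.exp (S.t i) := Real.one_le_exp (S.t_nonneg i)

lemma exp_neg_l_le_one (i : ℕ) : Real.exp (-S.l i) ≤ 1 :=
  Real.exp_le_one_iff.2 (by linarith [S.l_nonneg i])

lemma abs_le_exp {i j : ℕ} (h : i ≤ j) : |(S.x i 0 : ℝ)| ≤ Real.exp (S.t j) := by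
  rw [S.abs_eq]
  exact Real.exp_le_exp.2 (S.t_le h)

lemma err_le_exp {i j : ℕ} (h : i ≤ j) : err ξ (S.x j) ≤ Real.exp (-S.l i) := by
  rw [S.err_eq]
  exact Real.exp_le_exp.2 (neg_le_neg (S.l_le h))

lemma not_parallel {i j : ℕ} (hij : i < j) : ¬ Parallel (S.x i) (S.x j) := fun h => by
  refine absurd (S.l_strictMono hij) (not_lt.2 ?_)
  rw [← neg_le_neg_iff, ← Real.exp_le_exp, ← S.err_eq, ← S.err_eq]
  refine (pi_norm_le_iff_of_nonneg (err_nonneg _ _)).2 fun p => ?_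
  have h1 : (S.x j 0 : ℝ) * eps ξ (S.x i) p = S.x i 0 * eps ξ (S.x j) p := by
    have : (S.x i 0 * S.x j p : ℝ) = S.x i p * S.x j 0 := by exact_mod_cast h 0 p
    simp only [eps]
    linarith
  have h2 := congrArg abs h1
  rw [abs_mul, abs_mul, S.abs_eq, S.abs_eq] at h2
  have h3 : Real.exp (S.t j) * |eps ξ (S.x i) p| ≤ Real.exp (S.t j) * err ξ (S.x j) := by
    rw [h2]
    exact mul_le_mul (Real.exp_le_exp.2 (S.t_le hij.le)) (abs_eps_le _ _ _) (abs_nonneg _)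
      (Real.exp_pos _).le
  exact le_of_mul_le_mul_left h3 (Real.exp_pos _)

lemma not_parallel_of_ne {i j : ℕ} (hij : i ≠ j) : ¬ Parallel (S.x i) (S.x j) := fun h => by
  rcases hij.lt_or_gt with hij | hij
  · exact S.not_parallel hij h
  · exact S.not_parallel hij h.symm

lemma le_exp_t (i : ℕ) : (i : ℝ) ≤ Real.exp (S.t i) := by
  have hlt : ∀ i, |S.x i 0| < |S.x (i + 1) 0| := fun i => by
    have : |(S.x i 0 : ℝ)| < |(S.x (i + 1) 0 : ℝ)| := by
      rw [S.abs_eq, S.abs_eq]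
      exact Real.exp_lt_exp.2 (S.t_lt i.lt_succ_self)
    exact_mod_cast this
  have : (i : ℤ) ≤ |S.x i 0| := by
    induction i with
    | zero => simp
    | succ i ih =>
      have := hlt i
      push_cast
      omega
  rw [← S.abs_eq]
  exact_mod_cast this

lemma exists_lt_exp_t (T : ℝ) : ∃ n, ∀ i, n ≤ i → T < Real.exp (S.t i) := by
  obtain ⟨n, hn⟩ := exists_nat_gt T
  exact ⟨n, fun i hi => (hn.trans_le (by exact_mod_cast hi)).trans_le (S.le_exp_t i)⟩

/-- A non-zero rational linear form vanishes at only finitely many points. -/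
lemma exists_forall_dot_ne_zero {R : Fin 4 → ℤ} (hR : R ≠ 0) :
    ∃ n, ∀ i, n ≤ i → R ⬝ᵥ S.x i ≠ 0 := by
  set F : ℝ := R 0 + R 1 * ξ + R 2 * ξ ^ 2 + R 3 * ξ ^ 3 with hF
  have hF0 : 0 < |F| := abs_pos.2 (form_ne_zero S.indep hR)
  obtain ⟨n, hn⟩ := S.exists_lt_exp_t (4 * ‖R‖ / |F|)
  refine ⟨n, fun i hi h => ?_⟩
  have h' : (R 0 * S.x i 0 + R 1 * S.x i 1 + R 2 * S.x i 2 + R 3 * S.x i 3 : ℝ) = 0 := by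
    rw [dot_four] at h
    exact_mod_cast h
  have e := fun p => abs_le.1 (abs_mul_le_mul (abs_coord_le_norm R p)
    ((abs_eps_le ξ (S.x i) p).trans ((S.err_le_exp le_rfl).trans (S.exp_neg_l_le_one i))))
  have key : F * S.x i 0 = R 0 * eps ξ (S.x i) 0 + R 1 * eps ξ (S.x i) 1
      + R 2 * eps ξ (S.x i) 2 + R 3 * eps ξ (S.x i) 3 := by
    simp [eps, hF]
    linarith
  have h1 : |F * S.x i 0| ≤ 4 * ‖R‖ := by
    have e0 := e 0
    have e1 := e 1
    have e2 := e 2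
    have e3 := e 3
    rw [key, abs_le]
    constructor <;> linarith
  have h2 := hn i hi
  rw [div_lt_iff₀ hF0] at h2
  rw [abs_mul, S.abs_eq] at h1
  linarith

/-! ### Inequalities between the sizes of the points -/

lemma powBound_le_exp (S : PointSeq ξ lam k) {C : ℝ} (hC : C ≤ 1000) : C * powBound ξ ^ 2 ≤ Real.exp k :=
  (mul_le_mul_of_nonneg_right hC (sq_nonneg _)).trans S.le_exp

lemma norm_pairing_succ_le (i : ℕ) :
    ‖pairing (S.x i) (S.x (i + 1))‖
      ≤ 36 * powBound ξ ^ 2 * Real.exp (S.t (i + 1) - 2 * S.l i) := by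
  have h := norm_pairing_le (S.abs_le_exp i.le_succ) (S.one_le_exp_t _) (S.err_le_exp le_rfl)
    (S.exp_neg_l_le_one i) (S.abs_le_exp (le_refl (i + 1))) (S.err_le_exp i.le_succ)
  have e : Real.exp (S.t (i + 1) - 2 * S.l i)
      = Real.exp (S.t (i + 1)) * Real.exp (-S.l i) * Real.exp (-S.l i) := by
    rw [← Real.exp_add, ← Real.exp_add]
    ring_nf
  rw [e]
  linarith

lemma abs_pairing_le (i j : ℕ) :
    |ξ * pairing (S.x i) (S.x j) 0 - pairing (S.x i) (S.x j) 1|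
      ≤ 30 * powBound ξ ^ 2 * Real.exp (S.t i - S.l i - S.l j) := by
  have h := abs_pairing_eval_le (z := S.x j) (S.abs_le_exp (le_refl i)) (S.one_le_exp_t _)
    (S.err_le_exp le_rfl) (S.exp_neg_l_le_one i) (S.err_le_exp le_rfl)
  have e : Real.exp (S.t i - S.l i - S.l j)
      = Real.exp (S.t i) * Real.exp (-S.l i) * Real.exp (-S.l j) := by
    rw [← Real.exp_add, ← Real.exp_add]
    ring_nf
  rwa [e]

lemma lt_of_pairing_ne_zero {i : ℕ} (h : pairing (S.x (i + 1)) (S.x i) ≠ 0) :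
    lam * S.t (i + 2) < (1 - lam) * S.t (i + 1) := by
  have h1 := (one_le_norm h).trans (norm_pairing_le (S.abs_le_exp (le_refl (i + 1)))
    (S.one_le_exp_t _) (S.err_le_exp le_rfl) (S.exp_neg_l_le_one _)
    (S.abs_le_exp i.le_succ) (S.err_le_exp le_rfl))
  have e : Real.exp (S.t (i + 1) - S.l (i + 1) - S.l i)
      = Real.exp (S.t (i + 1)) * Real.exp (-S.l (i + 1)) * Real.exp (-S.l i) := by
    rw [← Real.exp_add, ← Real.exp_add]
    ring_nf
  have h2 : Real.exp (S.t (i + 1)) * Real.exp (-S.l (i + 1)) ^ 2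
      ≤ Real.exp (S.t (i + 1) - S.l (i + 1) - S.l i) := by
    rw [e, sq, ← mul_assoc]
    exact mul_le_mul_of_nonneg_left (Real.exp_le_exp.2 (neg_le_neg (S.l_le i.le_succ)))
      (by positivity)
  rw [← e] at h1
  have h3 : 1 ≤ 36 * powBound ξ ^ 2 * Real.exp (S.t (i + 1) - S.l (i + 1) - S.l i) := by
    nlinarith [sq_nonneg (powBound ξ)]
  have h4 := nonneg_of_one_le_mul_exp h3 (S.powBound_le_exp (by norm_num))
  have h5 := S.le_l i
  have h6 := S.le_l (i + 1)
  have := S.k_pos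
  linarith

lemma norm_cross_succ_le (a : ℕ) :
    ‖cross (S.x a) (S.x (a + 1)) (S.x (a + 2))‖
      ≤ 24 * powBound ξ * Real.exp (S.t (a + 2) - S.l a - S.l (a + 1)) := by
  have h := norm_cross_le (S.abs_le_exp (Nat.le_add_right a 2)) (S.abs_le_exp (a + 1).le_succ)
    (S.abs_le_exp (le_refl (a + 2))) (S.one_le_exp_t _) (S.err_le_exp (le_refl a))
    (S.err_le_exp (le_refl (a + 1))) (S.err_le_exp (a + 1).le_succ)
    (Real.exp_le_exp.2 (neg_le_neg (S.l_le a.le_succ))) (S.exp_neg_l_le_one _)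
  have e : Real.exp (S.t (a + 2) - S.l a - S.l (a + 1))
      = Real.exp (S.t (a + 2)) * Real.exp (-S.l a) * Real.exp (-S.l (a + 1)) := by
    rw [← Real.exp_add, ← Real.exp_add]
    ring_nf
  rwa [e]

lemma one_le_abs_dot {R w : Fin 4 → ℤ} (h : R ⬝ᵥ w ≠ 0) : 1 ≤ |((R ⬝ᵥ w : ℤ) : ℝ)| := by
  exact_mod_cast Int.one_le_abs h

lemma pos_of_dot_succ_ne_zero {a b : ℕ}
    (h0 : cross (S.x a) (S.x (a + 1)) (S.x (a + 2)) ⬝ᵥ S.x b = 0)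
    (h1 : cross (S.x a) (S.x (a + 1)) (S.x (a + 2)) ⬝ᵥ S.x (b + 1) ≠ 0) :
    0 < (1 - lam) * S.t (a + 2) - lam * S.t (a + 1) + (1 - lam) * S.t (b + 1) - S.t b := by
  have h2 := abs_dot_mul_le (ξ := ξ) (z := S.x (b + 1)) h0
  rw [S.abs_eq, S.abs_eq, S.err_eq, S.err_eq] at h2
  have h3 : Real.exp (S.t b) * Real.exp (-S.l (b + 1))
      ≤ Real.exp (S.t (b + 1)) * Real.exp (-S.l b) :=
    mul_le_mul (Real.exp_le_exp.2 (S.t_le b.le_succ))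
      (Real.exp_le_exp.2 (neg_le_neg (S.l_le b.le_succ))) (Real.exp_pos _).le (Real.exp_pos _).le
  have h4 := S.norm_cross_succ_le a
  set N := ‖cross (S.x a) (S.x (a + 1)) (S.x (a + 2))‖
  set P := Real.exp (S.t (b + 1)) * Real.exp (-S.l b) with hP
  have hP0 : 0 ≤ P := by positivity
  have h5 : Real.exp (S.t b) ≤ 192 * powBound ξ
      * (Real.exp (S.t (a + 2) - S.l a - S.l (a + 1)) * P) := by
    calc Real.exp (S.t b) ≤ _ := le_mul_of_one_le_left (Real.exp_pos _).le (one_le_abs_dot h1)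
      _ ≤ _ := h2
      _ ≤ 8 * N * P := by
        have : 4 * N * (P + Real.exp (S.t b) * Real.exp (-S.l (b + 1))) ≤ 4 * N * (P + P) :=
          mul_le_mul_of_nonneg_left (by linarith) (by positivity)
        linarith
      _ ≤ _ := by
        have := mul_le_mul_of_nonneg_right h4 hP0
        linarith
  have h6 : 1 ≤ 192 * powBound ξ
      * Real.exp (S.t (a + 2) - S.l a - S.l (a + 1) + S.t (b + 1) - S.l b - S.t b) := by
    have e : Real.exp (S.t (a + 2) - S.l a - S.l (a + 1) + S.t (b + 1) - S.l b - S.t b)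
        = Real.exp (S.t (a + 2) - S.l a - S.l (a + 1)) * P / Real.exp (S.t b) := by
      rw [hP, ← Real.exp_add, ← Real.exp_add, ← Real.exp_sub]
      ring_nf
    rw [e, ← mul_div_assoc, one_le_div (Real.exp_pos _)]
    exact h5
  have h7 := nonneg_of_one_le_mul_exp h6 ((by nlinarith [one_le_powBound ξ] :
    192 * powBound ξ ≤ 192 * powBound ξ ^ 2).trans (S.powBound_le_exp (by norm_num)))
  have := S.le_l a
  have := S.le_l (a + 1)
  have := S.le_l b
  have := S.k_pos
  linarith

lemma pos_of_dot_ne_zero {b d : ℕ} (hd : d ≤ b + 1)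
    (h1 : cross (S.x b) (S.x (b + 1)) (S.x (b + 2)) ⬝ᵥ S.x d ≠ 0) :
    0 < (1 - lam) * S.t (b + 2) - lam * S.t (b + 1) - lam * S.t (d + 1) := by
  have h2 := abs_dot_mul_le (ξ := ξ) (z := S.x d)
    (cross_dot_mid (S.x b) (S.x (b + 1)) (S.x (b + 2)))
  rw [S.abs_eq, S.abs_eq, S.err_eq, S.err_eq] at h2
  have h3 : Real.exp (S.t d) * Real.exp (-S.l (b + 1))
      ≤ Real.exp (S.t (b + 1)) * Real.exp (-S.l d) :=
    mul_le_mul (Real.exp_le_exp.2 (S.t_le hd))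
      (Real.exp_le_exp.2 (neg_le_neg (S.l_le hd))) (Real.exp_pos _).le (Real.exp_pos _).le
  have h4 := S.norm_cross_succ_le b
  set N := ‖cross (S.x b) (S.x (b + 1)) (S.x (b + 2))‖
  have h5 : 1 ≤ 8 * N * Real.exp (-S.l d) := by
    have h6 : 1 * Real.exp (S.t (b + 1))
        ≤ 8 * N * Real.exp (-S.l d) * Real.exp (S.t (b + 1)) := by
      calc _ ≤ _ := mul_le_mul_of_nonneg_right (one_le_abs_dot h1) (Real.exp_pos _).le
        _ ≤ _ := h2
        _ ≤ 4 * N * (2 * (Real.exp (S.t (b + 1)) * Real.exp (-S.l d))) :=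
          mul_le_mul_of_nonneg_left (by linarith) (by positivity)
        _ = _ := by ring
    exact le_of_mul_le_mul_right h6 (Real.exp_pos _)
  have h6 : 1 ≤ 192 * powBound ξ * Real.exp (S.t (b + 2) - S.l b - S.l (b + 1) - S.l d) := by
    have e : Real.exp (S.t (b + 2) - S.l b - S.l (b + 1) - S.l d)
        = Real.exp (S.t (b + 2) - S.l b - S.l (b + 1)) * Real.exp (-S.l d) := by
      rw [← Real.exp_add]
      ring_nf
    have := mul_le_mul_of_nonneg_right h4 (Real.exp_pos (-S.l d)).le
    rw [e]
    linarith
  have h7 := nonneg_of_one_le_mul_exp h6 ((by nlinarith [one_le_powBound ξ] :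
    192 * powBound ξ ≤ 192 * powBound ξ ^ 2).trans (S.powBound_le_exp (by norm_num)))
  have := S.le_l b
  have := S.le_l (b + 1)
  have := S.le_l d
  have := S.k_pos
  linarith

end PointSeq

/-! ### Primitive points -/

lemma exists_primitive {n : ℕ} {D : Fin n → ℤ} (hD : D ≠ 0) :
    ∃ (g : ℤ) (Q c : Fin n → ℤ), g ≠ 0 ∧ (∀ p, D p = g * Q p) ∧ c ⬝ᵥ Q = 1 := by
  obtain ⟨g, hg⟩ := (IsPrincipalIdealRing.principal (Ideal.span (Set.range D))).principal
  have hdvd : ∀ p, ∃ r, D p = g * r := fun p => by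
    have : D p ∈ Ideal.span (Set.range D) := Ideal.subset_span ⟨p, rfl⟩
    rw [hg] at this
    exact Ideal.mem_span_singleton.1 this
  choose Q hQ using hdvd
  have hg0 : g ≠ 0 := by
    rintro rfl
    exact hD (funext fun p => by simp [hQ p])
  obtain ⟨c, hc⟩ : ∃ c : Fin n → ℤ, ∑ p, c p * D p = g := by
    rw [← Ideal.mem_span_range_iff_exists_fun, hg]
    exact Ideal.mem_span_singleton_self g
  refine ⟨g, Q, c, hg0, hQ, mul_left_cancel₀ hg0 ?_⟩
  rw [mul_one]
  nth_rw 2 [← hc]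
  rw [dotProduct, Finset.mul_sum]
  exact Finset.sum_congr rfl fun p _ => by rw [hQ p]; ring

lemma Parallel.eq_mul {n : ℕ} {E Q c : Fin n → ℤ} (h : Parallel E Q) (hc : c ⬝ᵥ Q = 1)
    (p : Fin n) : E p = (c ⬝ᵥ E) * Q p := by
  rw [← mul_one (E p), ← hc, dotProduct, dotProduct, Finset.mul_sum, Finset.sum_mul]
  exact Finset.sum_congr rfl fun q _ => by linear_combination c q * h p q

lemma Parallel.trans {n : ℕ} {x y z : Fin n → ℤ} (h : Parallel x y) (hy : y ≠ 0)
    (h' : Parallel y z) : Parallel x z := fun p q => by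
  obtain ⟨r, hr⟩ := Function.ne_iff.1 hy
  refine mul_left_cancel₀ hr ?_
  linear_combination z q * h p r + x r * h' p q - z p * h q r

lemma Parallel.of_eq_mul {n : ℕ} {x y : Fin n → ℤ} {g : ℤ} (h : ∀ p, x p = g * y p) :
    Parallel x y := fun p q => by rw [h, h]; ring

lemma norm_le_of_eq_mul {n : ℕ} {x y : Fin n → ℤ} {g : ℤ} (hg : g ≠ 0)
    (h : ∀ p, x p = g * y p) : ‖y‖ ≤ ‖x‖ := by
  refine (pi_norm_le_iff_of_nonneg (norm_nonneg _)).2 fun p => ?_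
  refine le_trans ?_ (abs_coord_le_norm x p)
  rw [h p, Int.norm_eq_abs, Int.cast_mul, abs_mul]
  exact le_mul_of_one_le_left (abs_nonneg _) (by exact_mod_cast Int.one_le_abs hg)

lemma abs_eval_le_of_eq_mul {ξ : ℝ} {x y : Fin 2 → ℤ} {g : ℤ} (hg : g ≠ 0)
    (h : ∀ p, x p = g * y p) : |ξ * y 0 - y 1| ≤ |ξ * x 0 - x 1| := by
  have e : ξ * x 0 - x 1 = g * (ξ * y 0 - y 1) := by
    rw [h, h]
    push_cast
    ring
  rw [e, abs_mul]
  exact le_mul_of_one_le_left (abs_nonneg _) (by exact_mod_cast Int.one_le_abs hg)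

lemma Parallel.exists_common {ξ : ℝ} {D E : Fin 2 → ℤ} (h : Parallel E D) (hD : D ≠ 0)
    (hE : E ≠ 0) : ∃ Q : Fin 2 → ℤ, Q ≠ 0 ∧ Parallel D Q ∧ ‖Q‖ ≤ ‖D‖ ∧
      |ξ * Q 0 - Q 1| ≤ |ξ * E 0 - E 1| := by
  obtain ⟨g, Q, c, hg, hQ, hc⟩ := exists_primitive hD
  have hDQ : Parallel D Q := Parallel.of_eq_mul hQ
  have hEQ := (h.trans hD hDQ).eq_mul hc
  refine ⟨Q, fun h0 => hD (funext fun p => by simp [hQ p, h0]), hDQ, norm_le_of_eq_mul hg hQ,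
    abs_eval_le_of_eq_mul (fun h0 => hE (funext fun p => ?_)) hEQ⟩
  rw [hEQ p, h0, zero_mul]
  rfl

namespace PointSeq

variable {ξ lam k : ℝ} (S : PointSeq ξ lam k)

lemma lt_or_lt_of_not_parallel {i j m : ℕ}
    (hd : ¬ Parallel (pairing (S.x i) (S.x (i + 1))) (pairing (S.x j) (S.x (j + 1))))
    (hi : Parallel (pairing (S.x i) (S.x j)) (pairing (S.x i) (S.x (i + 1))))
    (hi0 : pairing (S.x i) (S.x j) ≠ 0)
    (hj : Parallel (pairing (S.x j) (S.x m)) (pairing (S.x j) (S.x (j + 1))))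
    (hj0 : pairing (S.x j) (S.x m) ≠ 0) :
    3 * lam * S.t (j + 1) + lam * S.t (i + 1) < S.t (j + 1) + S.t i ∨
      2 * lam * S.t (i + 1) + lam * S.t (j + 1) + lam * S.t (m + 1) < S.t (i + 1) + S.t j := by
  have hdi : pairing (S.x i) (S.x (i + 1)) ≠ 0 := fun h => hd fun p q => by simp [h]
  have hdj : pairing (S.x j) (S.x (j + 1)) ≠ 0 := fun h => hd fun p q => by simp [h]
  obtain ⟨Q, hQ0, hQ, hQn, hQe⟩ := hi.exists_common (ξ := ξ) hdi hi0
  obtain ⟨P, hP0, hP, hPn, hPe⟩ := hj.exists_common (ξ := ξ) hdj hj0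
  have hQP : Q 0 * P 1 - Q 1 * P 0 ≠ 0 := fun h => by
    refine hd ((hQ.trans hQ0 ?_).trans hP0 hP.symm)
    intro p q
    fin_cases p <;> fin_cases q <;> simp <;> linarith
  have h1 : (1 : ℝ) ≤ |((Q 0 * P 1 - Q 1 * P 0 : ℤ) : ℝ)| := by
    exact_mod_cast Int.one_le_abs hQP
  have e : ((Q 0 * P 1 - Q 1 * P 0 : ℤ) : ℝ) = P 0 * (ξ * Q 0 - Q 1) - Q 0 * (ξ * P 0 - P 1) := by
    push_cast
    ring
  have hle1 := abs_mul_le_mul ((abs_coord_le_norm P 0).trans (hPn.trans (S.norm_pairing_succ_le j)))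
    (hQe.trans (S.abs_pairing_le i j))
  have hle2 := abs_mul_le_mul ((abs_coord_le_norm Q 0).trans (hQn.trans (S.norm_pairing_succ_le i)))
    (hPe.trans (S.abs_pairing_le j m))
  rw [e] at h1
  have h2 := h1.trans ((abs_sub _ _).trans (add_le_add hle1 hle2))
  have hK : 2160 * powBound ξ ^ 4 ≤ Real.exp (2 * k) := by
    have h3 := S.le_exp
    have h4 : Real.exp (2 * k) = Real.exp k * Real.exp k := by rw [← Real.exp_add]; ring_nf
    have h5 := mul_le_mul h3 h3 (by positivity) (Real.exp_pos _).le
    have h6 : 0 ≤ powBound ξ ^ 4 := by positivity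
    rw [h4]
    nlinarith
  have li := S.le_l i
  have lj := S.le_l j
  have lm := S.le_l m
  have hk := S.k_pos
  by_cases hc : 1 ≤ 2160 * powBound ξ ^ 4
      * Real.exp (S.t (j + 1) - 2 * S.l j + (S.t i - S.l i - S.l j))
  · have := nonneg_of_one_le_mul_exp hc hK
    left
    linarith
  · have hc' : 1 ≤ 2160 * powBound ξ ^ 4
        * Real.exp (S.t (i + 1) - 2 * S.l i + (S.t j - S.l j - S.l m)) := by
      rw [Real.exp_add] at hc ⊢
      linarith
    have := nonneg_of_one_le_mul_exp hc' hK
    right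
    linarith

end PointSeq

/-! ### Non-degeneracy of the Hessian covariants -/

/-- A cubic form with vanishing Hessian covariant is a multiple of a cube. -/
lemma exists_cube_of_hess_eq_zero {x : Fin 4 → ℤ} (hx : x 0 ≠ 0) (h : hess x = 0) :
    ∃ g a b : ℤ, g ≠ 0 ∧ a ≠ 0 ∧ x 0 = g * a ^ 3 ∧ x 1 = g * a ^ 2 * b ∧ x 2 = g * a * b ^ 2 ∧
      x 3 = g * b ^ 3 := by
  have h1 : x 1 * x 2 - x 0 * x 3 = 0 := by simpa [hess] using congrFun h 1
  have h2 : x 0 * x 2 - x 1 ^ 2 = 0 := by simpa [hess] using congrFun h 2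
  obtain ⟨g₁, D, c, hg₁, hD, hc⟩ := exists_primitive (D := ![x 0, x 1])
    (fun h => hx (by simpa using congrFun h 0))
  have hx0 : x 0 = g₁ * D 0 := by simpa using hD 0
  have hx1 : x 1 = g₁ * D 1 := by simpa using hD 1
  have hc' : c 0 * D 0 + c 1 * D 1 = 1 := by simpa [dotProduct, Fin.sum_univ_two] using hc
  generalize D 0 = a at *
  generalize D 1 = b at *
  have ha : a ≠ 0 := fun ha => hx (by rw [hx0, ha, mul_zero])
  have hcop : IsCoprime a b := ⟨c 0, c 1, hc'⟩
  have h3 : a * x 2 = g₁ * b ^ 2 := by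
    refine mul_left_cancel₀ hg₁ ?_
    rw [hx0, hx1] at h2
    linear_combination h2
  obtain ⟨g₂, rfl⟩ : a ∣ g₁ := (hcop.pow_right (n := 2)).dvd_of_dvd_mul_right ⟨_, h3.symm⟩
  have hg₂ : g₂ ≠ 0 := right_ne_zero_of_mul hg₁
  have hx2 : x 2 = g₂ * b ^ 2 := mul_left_cancel₀ ha (by linear_combination h3)
  have h4 : a * x 3 = g₂ * b ^ 3 := by
    refine mul_left_cancel₀ hg₂ (mul_left_cancel₀ ha ?_)
    rw [hx0, hx1, hx2] at h1
    linear_combination -h1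
  obtain ⟨g, rfl⟩ : a ∣ g₂ := (hcop.pow_right (n := 3)).dvd_of_dvd_mul_right ⟨_, h4.symm⟩
  exact ⟨g, a, b, right_ne_zero_of_mul hg₂, ha, by rw [hx0]; ring, by rw [hx1]; ring,
    by rw [hx2]; ring, mul_left_cancel₀ ha (by linear_combination h4)⟩

lemma parallel_cube {y x : Fin 4 → ℤ} {g a b : ℤ} (hx0 : x 0 = g * a ^ 3)
    (hx1 : x 1 = g * a ^ 2 * b) (hx2 : x 2 = g * a * b ^ 2) (hx3 : x 3 = g * b ^ 3)
    (h0 : a * y 1 - b * y 0 = 0) (h1 : a * y 2 - b * y 1 = 0) (h2 : a * y 3 - b * y 2 = 0) :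
    Parallel y x := by
  have k01 : y 0 * x 1 = y 1 * x 0 := by rw [hx0, hx1]; linear_combination -g * a ^ 2 * h0
  have k12 : y 1 * x 2 = y 2 * x 1 := by rw [hx1, hx2]; linear_combination -g * a * b * h1
  have k23 : y 2 * x 3 = y 3 * x 2 := by rw [hx2, hx3]; linear_combination -g * b ^ 2 * h2
  have k02 : y 0 * x 2 = y 2 * x 0 := by
    rw [hx0, hx2]; linear_combination -g * a * b * h0 - g * a ^ 2 * h1
  have k13 : y 1 * x 3 = y 3 * x 1 := by
    rw [hx1, hx3]; linear_combination -g * b ^ 2 * h1 - g * a * b * h2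
  have k03 : y 0 * x 3 = y 3 * x 0 := by
    rw [hx0, hx3]; linear_combination -g * b ^ 2 * h0 - g * a * b * h1 - g * a ^ 2 * h2
  intro p q
  fin_cases p <;> fin_cases q <;> simp <;> first | assumption | (symm; assumption)

lemma contract_hess_self (x : Fin 4 → ℤ) : contract (hess x) x = 0 := by
  ext p
  fin_cases p <;> simp [contract, hess] <;> ring

lemma contract_eq_zero_iff {q : Fin 3 → ℤ} {y : Fin 4 → ℤ} : contract q y = 0 ↔
    q 0 * y 0 + q 1 * y 1 + q 2 * y 2 = 0 ∧ q 0 * y 1 + q 1 * y 2 + q 2 * y 3 = 0 :=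
  ⟨fun h => ⟨congrFun h 0, congrFun h 1⟩, fun h => by
    ext p
    fin_cases p
    · exact h.1
    · exact h.2⟩

lemma parallel_hess {q : Fin 3 → ℤ} {y : Fin 4 → ℤ} (h : contract q y = 0) :
    Parallel q (hess y) := by
  obtain ⟨hA, hB⟩ := contract_eq_zero_iff.1 h
  have k01 : q 0 * hess y 1 = q 1 * hess y 0 := by
    simp [hess]; linear_combination y 2 * hB - y 3 * hA
  have k02 : q 0 * hess y 2 = q 2 * hess y 0 := by
    simp [hess]; linear_combination -y 1 * hB + y 2 * hA
  have k12 : q 1 * hess y 2 = q 2 * hess y 1 := by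
    simp [hess]; linear_combination y 0 * hB - y 1 * hA
  intro p r
  fin_cases p <;> fin_cases r <;> simp <;> first | assumption | (symm; assumption)

lemma Parallel.contract_eq_zero {q r : Fin 3 → ℤ} {y : Fin 4 → ℤ} (h : Parallel q r)
    (hr : r ≠ 0) (hy : contract r y = 0) : contract q y = 0 := by
  obtain ⟨hA, hB⟩ := contract_eq_zero_iff.1 hy
  obtain ⟨p, hp⟩ := Function.ne_iff.1 hr
  refine contract_eq_zero_iff.2 ⟨mul_left_cancel₀ hp ?_, mul_left_cancel₀ hp ?_⟩
  · linear_combination q p * hA - y 0 * h p 0 - y 1 * h p 1 - y 2 * h p 2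
  · linear_combination q p * hB - y 1 * h p 0 - y 2 * h p 1 - y 3 * h p 2

/-- If two independent cubic forms are apolar to the same primitive quadratic form `a`, then the
coefficients of `a` are bounded in terms of their `2 × 2` minors. -/
lemma sq_le_of_contract_eq_zero {a c : Fin 3 → ℤ} {x y : Fin 4 → ℤ} (hc : c ⬝ᵥ a = 1)
    (hx : contract a x = 0) (hy : contract a y = 0) (hxy : ¬ Parallel x y) {N : ℝ}
    (hN : ∀ p q, |(x p * y q - x q * y p : ℝ)| ≤ N) (p : Fin 3) : |(a p : ℝ)| ^ 2 ≤ 2 * N := by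
  obtain ⟨hA, hB⟩ := contract_eq_zero_iff.1 hx
  obtain ⟨hA', hB'⟩ := contract_eq_zero_iff.1 hy
  let m : Fin 4 → Fin 4 → ℤ := fun p q => x p * y q - x q * y p
  have hm : ∀ p q, m p q = x p * y q - x q * y p := fun _ _ => rfl
  have a0 : a 1 * m 0 1 + a 2 * m 0 2 = 0 := by
    simp only [hm]; linear_combination x 0 * hA' - y 0 * hA
  have a1 : a 0 * m 0 1 - a 2 * m 1 2 = 0 := by
    simp only [hm]; linear_combination y 1 * hA - x 1 * hA'
  have a2 : a 0 * m 0 2 + a 1 * m 1 2 = 0 := by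
    simp only [hm]; linear_combination y 2 * hA - x 2 * hA'
  have a3 : a 0 * m 0 3 + a 1 * m 1 3 + a 2 * m 2 3 = 0 := by
    simp only [hm]; linear_combination y 3 * hA - x 3 * hA'
  have b0 : a 0 * m 0 1 + a 1 * m 0 2 + a 2 * m 0 3 = 0 := by
    simp only [hm]; linear_combination x 0 * hB' - y 0 * hB
  have b1 : a 1 * m 1 2 + a 2 * m 1 3 = 0 := by
    simp only [hm]; linear_combination x 1 * hB' - y 1 * hB
  have b2 : a 0 * m 1 2 - a 2 * m 2 3 = 0 := by
    simp only [hm]; linear_combination y 2 * hB - x 2 * hB'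
  have b3 : a 0 * m 1 3 + a 1 * m 2 3 = 0 := by
    simp only [hm]; linear_combination y 3 * hB - x 3 * hB'
  let V : Fin 3 → Fin 3 → ℤ := ![![m 2 3, -m 1 3, m 1 2],
    ![-m 1 3, m 0 3 + m 1 2, -m 0 2], ![m 1 2, -m 0 2, m 0 1]]
  have hV : ∀ r, Parallel (V r) a := fun r p q => by
    fin_cases r <;> fin_cases p <;> fin_cases q <;> simp [V] <;> linarith
  have hsymm : ∀ r s, V r s = V s r := fun r s => by
    fin_cases r <;> fin_cases s <;> simp [V]
  have hw : Parallel (fun r => c ⬝ᵥ V r) a := fun r s => by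
    have h1 := (hV r).eq_mul hc s
    have h2 := (hV s).eq_mul hc r
    show (c ⬝ᵥ V r) * a s = (c ⬝ᵥ V s) * a r
    rw [← h1, ← h2, hsymm]
  set κ := c ⬝ᵥ fun r => c ⬝ᵥ V r with hκ
  have hVκ : ∀ r s, V r s = κ * (a r * a s) := fun r s => by
    rw [(hV r).eq_mul hc s, show c ⬝ᵥ V r = κ * a r from hw.eq_mul hc r]
    ring
  have hκ0 : κ ≠ 0 := fun h0 => hxy fun p q => by
    have hz : ∀ r s, V r s = 0 := fun r s => by rw [hVκ, h0, zero_mul]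
    have z00 := hz 0 0
    have z01 := hz 0 1
    have z02 := hz 0 2
    have z11 := hz 1 1
    have z12 := hz 1 2
    have z22 := hz 2 2
    simp [V, m] at z00 z01 z02 z11 z12 z22
    fin_cases p <;> fin_cases q <;> simp <;> linarith
  have hκ1 : (1 : ℝ) ≤ |(κ : ℝ)| := by exact_mod_cast Int.one_le_abs hκ0
  have hbound : |(V p p : ℝ)| ≤ 2 * N := by
    have h0 := hN 2 3
    have h1 := abs_le.1 (hN 0 3)
    have h2 := abs_le.1 (hN 1 2)
    have h3 := hN 0 1
    have hN0 := (abs_nonneg _).trans h0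
    fin_cases p <;> simp [V, m]
    · linarith
    · rw [abs_le]
      constructor <;> linarith
    · linarith
  rw [hVκ p p] at hbound
  push_cast at hbound
  rw [abs_mul, ← sq, abs_pow] at hbound
  nlinarith [sq_nonneg |(a p : ℝ)|]

namespace PointSeq

variable {ξ lam k : ℝ} (S : PointSeq ξ lam k)

lemma hess_ne_zero (i : ℕ) : hess (S.x (i + 1)) ≠ 0 := fun h => by
  obtain ⟨g, a, b, hg, ha, h0, h1, h2, h3⟩ :=
    exists_cube_of_hess_eq_zero (S.x_zero_ne_zero (i + 1)) h
  have hM := one_le_powBound ξ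
  have hg1 : (1 : ℝ) ≤ |(g : ℝ)| := by exact_mod_cast Int.one_le_abs hg
  have ha1 : (1 : ℝ) ≤ |(a : ℝ)| := by exact_mod_cast Int.one_le_abs ha
  set L := Real.exp (-S.l i) with hL
  have hL0 : 0 < L := Real.exp_pos _
  have hX : |(g : ℝ)| * |(a : ℝ)| ^ 3 = Real.exp (S.t (i + 1)) := by
    rw [← S.abs_eq, h0]
    push_cast
    rw [abs_mul, abs_pow]
  have hgξ : |(g : ℝ)| * |(a : ℝ)| ^ 2 * |a * ξ - b| ≤ L := by
    have := (abs_eps_le ξ (S.x (i + 1)) 1).trans (S.err_le_exp i.le_succ)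
    have e : eps ξ (S.x (i + 1)) 1 = g * a ^ 2 * (a * ξ - b) := by
      simp [eps, h0, h1]
      ring
    rwa [e, abs_mul, abs_mul, abs_pow] at this
  have hξab : |a * ξ - b| ≤ L := by
    refine le_trans (le_mul_of_one_le_left (abs_nonneg _) ?_) hgξ
    exact one_le_mul_of_one_le_of_one_le hg1 (one_le_pow₀ ha1)
  have hb : |(b : ℝ)| ≤ 2 * powBound ξ * |(a : ℝ)| := by
    have hξ1 := abs_mul_le_mul (le_refl |(a : ℝ)|) (abs_pow_le_powBound ξ 1)
    have hL1 := S.exp_neg_l_le_one i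
    have e : (b : ℝ) = a * ξ ^ ((1 : Fin 4) : ℕ) - (a * ξ - b) := by simp
    rw [e]
    refine (abs_sub _ _).trans ?_
    nlinarith
  have hXab : Real.exp (S.t i) * |a * ξ - b| ≤ |(a : ℝ)| * L := by
    calc _ ≤ |(g : ℝ)| * |(a : ℝ)| ^ 3 * |a * ξ - b| := by
          rw [hX]
          exact mul_le_mul_of_nonneg_right (Real.exp_le_exp.2 (S.t_le i.le_succ)) (abs_nonneg _)
      _ = |(a : ℝ)| * (|(g : ℝ)| * |(a : ℝ)| ^ 2 * |a * ξ - b|) := by ring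
      _ ≤ _ := mul_le_mul_of_nonneg_left hgξ (abs_nonneg _)
  have key : ∀ p q : Fin 4, (q : ℕ) = p + 1 →
      |((a * S.x i q - b * S.x i p : ℤ) : ℝ)| ≤ 4 * powBound ξ * (|(a : ℝ)| * L) := by
    intro p q hpq
    have e : ((a * S.x i q - b * S.x i p : ℤ) : ℝ) = ξ ^ (p : ℕ) * (S.x i 0 * (a * ξ - b))
        - a * eps ξ (S.x i) q + b * eps ξ (S.x i) p := by
      push_cast
      rw [coord_eq ξ (S.x i) p, coord_eq ξ (S.x i) q, hpq]
      ring
    have e1 : |(S.x i 0 : ℝ) * (a * ξ - b)| ≤ |(a : ℝ)| * L := by rwa [abs_mul, S.abs_eq]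
    have t1 := abs_le.1 (abs_mul_le_mul (abs_pow_le_powBound ξ p) e1)
    have t2 := abs_le.1 (abs_mul_le_mul (le_refl |(a : ℝ)|)
      ((abs_eps_le ξ (S.x i) q).trans (S.err_le_exp le_rfl)))
    have t3 := abs_le.1 (abs_mul_le_mul hb
      ((abs_eps_le ξ (S.x i) p).trans (S.err_le_exp le_rfl)))
    rw [← hL] at t2 t3
    have t4 : |(a : ℝ)| * L ≤ powBound ξ * (|(a : ℝ)| * L) :=
      le_mul_of_one_le_left (by positivity) hM
    rw [e, abs_le]
    constructor <;> linarith
  have hone : 1 ≤ 4 * powBound ξ * (|(a : ℝ)| * L) := by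
    by_contra hlt
    have hz : ∀ p q : Fin 4, (q : ℕ) = p + 1 → a * S.x i q - b * S.x i p = 0 := by
      intro p q hpq
      by_contra hne
      exact hlt (le_trans (by exact_mod_cast Int.one_le_abs hne) (key p q hpq))
    exact S.not_parallel i.lt_succ_self
      (parallel_cube h0 h1 h2 h3 (hz 0 1 rfl) (hz 1 2 rfl) (hz 2 3 rfl))
  have hcube : 1 ≤ 64 * powBound ξ ^ 3 * Real.exp (S.t (i + 1) - 3 * S.l i) := by
    have e : Real.exp (S.t (i + 1) - 3 * S.l i) = Real.exp (S.t (i + 1)) * L ^ 3 := by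
      rw [hL, ← Real.exp_nat_mul, ← Real.exp_add]
      push_cast
      ring_nf
    calc (1 : ℝ) ≤ (4 * powBound ξ * (|(a : ℝ)| * L)) ^ 3 := one_le_pow₀ hone
      _ = 64 * powBound ξ ^ 3 * (1 * |(a : ℝ)| ^ 3 * L ^ 3) := by ring
      _ ≤ 64 * powBound ξ ^ 3 * (|(g : ℝ)| * |(a : ℝ)| ^ 3 * L ^ 3) := by gcongr
      _ = _ := by rw [hX, e]
  have hK : 64 * powBound ξ ^ 3 ≤ Real.exp (2 * k) := by
    have h4 : Real.exp (2 * k) = Real.exp k * Real.exp k := by rw [← Real.exp_add]; ring_nf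
    have h5 := mul_le_mul S.le_exp S.le_exp (by positivity) (Real.exp_pos _).le
    have h6 : powBound ξ ^ 3 ≤ powBound ξ ^ 4 := pow_le_pow_right₀ hM (by norm_num)
    have h7 : 0 ≤ powBound ξ ^ 4 := by positivity
    rw [h4]
    linarith
  have := nonneg_of_one_le_mul_exp hcube hK
  have := S.le_l i
  have := S.k_pos
  nlinarith [S.le_lam, S.t_nonneg (i + 1)]

lemma abs_minor_succ_le (i : ℕ) (p q : Fin 4) :
    |(S.x i p * S.x (i + 1) q - S.x i q * S.x (i + 1) p : ℝ)|
      ≤ 6 * powBound ξ * (Real.exp (S.t (i + 1)) * Real.exp (-S.l i)) := by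
  have e := fun p => (abs_eps_le ξ (S.x i) p).trans (S.err_le_exp le_rfl)
  have f := fun p => (abs_eps_le ξ (S.x (i + 1)) p).trans (S.err_le_exp i.le_succ)
  have c1 := fun p q => abs_le.1 (abs_mul_mul_le (abs_pow_le_powBound ξ p)
    (S.abs_le_exp i.le_succ) (f q))
  have c2 := fun p q => abs_le.1 (abs_mul_mul_le (abs_pow_le_powBound ξ p)
    (S.abs_le_exp (le_refl (i + 1))) (e q))
  have c3 := fun p q => abs_le.1 (abs_mul_le_mul
    ((e p).trans ((S.exp_neg_l_le_one i).trans (S.one_le_exp_t (i + 1)))) (f q))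
  have hM : Real.exp (S.t (i + 1)) * Real.exp (-S.l i)
      ≤ powBound ξ * (Real.exp (S.t (i + 1)) * Real.exp (-S.l i)) :=
    le_mul_of_one_le_left (by positivity) (one_le_powBound ξ)
  rw [coord_eq ξ (S.x i) p, coord_eq ξ (S.x i) q, coord_eq ξ (S.x (i + 1)) p,
    coord_eq ξ (S.x (i + 1)) q, abs_le]
  have d1 := c1 p q
  have d2 := c1 q p
  have d3 := c2 p q
  have d4 := c2 q p
  have d5 := c3 p q
  have d6 := c3 q p
  constructor <;> linarith

lemma one_le_mul_of_contract {a : Fin 3 → ℤ} {i : ℕ} (h : contract a (S.x (i + 1)) = 0)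
    (h' : contract a (S.x i) ≠ 0) : 1 ≤ 8 * ‖a‖ * Real.exp (-S.l i) := by
  obtain ⟨hA, hB⟩ := contract_eq_zero_iff.1 h
  have key : ∀ R : Fin 4 → ℤ, ‖R‖ ≤ ‖a‖ → R ⬝ᵥ S.x (i + 1) = 0 → R ⬝ᵥ S.x i ≠ 0 →
      1 ≤ 8 * ‖a‖ * Real.exp (-S.l i) := by
    intro R hR h0 h1
    have h2 := abs_dot_mul_le (ξ := ξ) (z := S.x i) h0
    rw [S.abs_eq, S.abs_eq, S.err_eq, S.err_eq] at h2
    have h3 : Real.exp (S.t i) * Real.exp (-S.l (i + 1))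
        ≤ Real.exp (S.t (i + 1)) * Real.exp (-S.l i) :=
      mul_le_mul (Real.exp_le_exp.2 (S.t_le i.le_succ))
        (Real.exp_le_exp.2 (neg_le_neg (S.l_le i.le_succ))) (Real.exp_pos _).le (Real.exp_pos _).le
    have h6 : 1 * Real.exp (S.t (i + 1))
        ≤ 8 * ‖a‖ * Real.exp (-S.l i) * Real.exp (S.t (i + 1)) := by
      calc _ ≤ _ := mul_le_mul_of_nonneg_right (one_le_abs_dot h1) (Real.exp_pos _).le
        _ ≤ _ := h2
        _ ≤ 4 * ‖a‖ * (2 * (Real.exp (S.t (i + 1)) * Real.exp (-S.l i))) :=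
          mul_le_mul (by linarith) (by linarith) (by positivity) (by positivity)
        _ = _ := by ring
    exact le_of_mul_le_mul_right h6 (Real.exp_pos _)
  have hn := fun p => norm_le_pi_norm a p
  by_cases h1 : a 0 * S.x i 0 + a 1 * S.x i 1 + a 2 * S.x i 2 = 0
  · have h2 : a 0 * S.x i 1 + a 1 * S.x i 2 + a 2 * S.x i 3 ≠ 0 :=
      fun h2 => h' (contract_eq_zero_iff.2 ⟨h1, h2⟩)
    refine key ![0, a 0, a 1, a 2] ?_ ?_ ?_
    · refine (pi_norm_le_iff_of_nonneg (norm_nonneg _)).2 fun p => ?_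
      fin_cases p
      · simp
      · exact hn 0
      · exact hn 1
      · exact hn 2
    · rw [dot_four]
      simpa using hB
    · rw [dot_four]
      simpa using h2
  · refine key ![a 0, a 1, a 2, 0] ?_ ?_ ?_
    · refine (pi_norm_le_iff_of_nonneg (norm_nonneg _)).2 fun p => ?_
      fin_cases p
      · exact hn 0
      · exact hn 1
      · exact hn 2
      · simp
    · rw [dot_four]
      simpa using hA
    · rw [dot_four]
      simpa using h1

lemma pairing_eq_zero_of_succ (i : ℕ) (h : pairing (S.x (i + 1)) (S.x (i + 2)) = 0) :
    pairing (S.x i) (S.x (i + 1)) = 0 := by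
  by_contra h'
  obtain ⟨g, a, c, hg, ha, hc⟩ := exists_primitive (S.hess_ne_zero i)
  have hpar : Parallel a (hess (S.x (i + 1))) := (Parallel.of_eq_mul ha).symm
  have h1 : contract a (S.x (i + 1)) = 0 :=
    hpar.contract_eq_zero (S.hess_ne_zero i) (contract_hess_self _)
  have h2 : contract a (S.x (i + 2)) = 0 := hpar.contract_eq_zero (S.hess_ne_zero i) h
  have ha0 : a ≠ 0 := fun h0 => by simp [h0] at hc
  have h3 : contract a (S.x i) ≠ 0 := fun h0 =>
    h' ((parallel_hess h0).symm.contract_eq_zero ha0 h1)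
  have b1 := S.one_le_mul_of_contract h1 h3
  have hess_le := abs_hess_le (S.abs_le_exp (le_refl (i + 1))) (S.one_le_exp_t _)
    (S.err_le_exp (le_refl (i + 1))) (S.exp_neg_l_le_one _)
  have b2 : ‖a‖ ≤ 6 * powBound ξ * (Real.exp (S.t (i + 1)) * Real.exp (-S.l (i + 1))) := by
    refine (norm_le_of_eq_mul hg ha).trans ?_
    refine (pi_norm_le_iff_of_nonneg ((abs_nonneg _).trans (hess_le 0))).2 fun p => ?_
    rw [Int.norm_eq_abs]
    exact hess_le p
  have b3 : ‖a‖ ^ 2 ≤ 12 * powBound ξ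
      * (Real.exp (S.t (i + 2)) * Real.exp (-S.l (i + 1))) := by
    have hsq := sq_le_of_contract_eq_zero hc h1 h2 (S.not_parallel (i + 1).lt_succ_self)
      (S.abs_minor_succ_le (i + 1))
    refine (Real.le_sqrt' (by linarith [one_le_norm ha0])).1 ?_
    refine (pi_norm_le_iff_of_nonneg (Real.sqrt_nonneg _)).2 fun p => ?_
    rw [Int.norm_eq_abs]
    refine Real.le_sqrt_of_sq_le ((hsq p).trans (le_of_eq ?_))
    ring
  have hM := one_le_powBound ξ
  have c1 : 1 ≤ 48 * powBound ξ * Real.exp (S.t (i + 1) - S.l (i + 1) - S.l i) := by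
    have e : Real.exp (S.t (i + 1) - S.l (i + 1) - S.l i)
        = Real.exp (S.t (i + 1)) * Real.exp (-S.l (i + 1)) * Real.exp (-S.l i) := by
      rw [← Real.exp_add, ← Real.exp_add]
      ring_nf
    rw [e]
    have := mul_le_mul_of_nonneg_right b2 (Real.exp_pos (-S.l i)).le
    linarith
  have c2 : 1 ≤ 768 * powBound ξ * Real.exp (S.t (i + 2) - S.l (i + 1) - 2 * S.l i) := by
    have e : Real.exp (S.t (i + 2) - S.l (i + 1) - 2 * S.l i)
        = Real.exp (S.t (i + 2)) * Real.exp (-S.l (i + 1)) * Real.exp (-S.l i) ^ 2 := by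
      rw [← Real.exp_nat_mul, ← Real.exp_add, ← Real.exp_add]
      push_cast
      ring_nf
    rw [e]
    calc (1 : ℝ) ≤ (8 * ‖a‖ * Real.exp (-S.l i)) ^ 2 := one_le_pow₀ b1
      _ = 64 * ‖a‖ ^ 2 * Real.exp (-S.l i) ^ 2 := by ring
      _ ≤ 64 * (12 * powBound ξ * (Real.exp (S.t (i + 2)) * Real.exp (-S.l (i + 1))))
          * Real.exp (-S.l i) ^ 2 := by gcongr
      _ = _ := by ring
  have hMsq : powBound ξ ≤ powBound ξ ^ 2 := by nlinarith
  have d1 := nonneg_of_one_le_mul_exp c1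
    ((by linarith : _ ≤ 48 * powBound ξ ^ 2).trans (S.powBound_le_exp (by norm_num)))
  have d2 := nonneg_of_one_le_mul_exp c2
    ((by linarith : _ ≤ 768 * powBound ξ ^ 2).trans (S.powBound_le_exp (by norm_num)))
  have := S.le_l i
  have := S.le_l (i + 1)
  have := S.k_pos
  have := mul_nonneg (sub_nonneg.2 S.le_lam) (S.t_nonneg (i + 1))
  have := mul_nonneg (sub_nonneg.2 S.le_lam) (S.t_nonneg (i + 2))
  have := S.t_nonneg (i + 1)
  linarith

lemma exists_pairing_ne_zero (i : ℕ) :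
    ∃ n, pairing (S.x (i + n + 1)) (S.x (i + n + 2)) ≠ 0 := by
  by_contra! h
  have hpar : ∀ n, Parallel (hess (S.x (i + 1))) (hess (S.x (i + n + 1))) := fun n => by
    induction n with
    | zero => exact fun p q => mul_comm _ _
    | succ n ih => exact ih.trans (S.hess_ne_zero _) (parallel_hess (h n))
  obtain ⟨m, hm⟩ := S.exists_forall_dot_ne_zero
    (R := ![hess (S.x (i + 1)) 0, hess (S.x (i + 1)) 1, hess (S.x (i + 1)) 2, 0]) fun h0 =>
      S.hess_ne_zero i (funext fun p => by
        fin_cases p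
        · exact congrFun h0 0
        · exact congrFun h0 1
        · exact congrFun h0 2)
  have h1 := (hpar m).contract_eq_zero (S.hess_ne_zero _) (contract_hess_self _)
  refine hm (i + m + 1) (by omega) ?_
  rw [dot_four]
  simpa using (contract_eq_zero_iff.1 h1).1

lemma exists_nondegenerate (S : PointSeq ξ lam k) : ∃ S' : PointSeq ξ lam k,
    (∀ i, pairing (S'.x i) (S'.x (i + 1)) ≠ 0) ∧ ∀ i, pairing (S'.x (i + 1)) (S'.x i) ≠ 0 := by
  obtain ⟨n, hn⟩ := S.exists_pairing_ne_zero 0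
  have key : ∀ i, pairing (S.x (i + (n + 1))) (S.x (i + (n + 1) + 1)) ≠ 0 := fun i => by
    induction i with
    | zero => simpa using hn
    | succ i ih =>
      intro h
      refine ih (S.pairing_eq_zero_of_succ _ ?_)
      rw [show i + (n + 1) + 1 = i + 1 + (n + 1) by omega,
        show i + (n + 1) + 2 = i + 1 + (n + 1) + 1 by omega]
      exact h
  refine ⟨S.shift (n + 1), fun i => ?_, fun i h => key i ?_⟩
  · have := key i
    rwa [show i + (n + 1) + 1 = i + 1 + (n + 1) by omega] at this
  · have h0 := S.hess_ne_zero (i + (n + 1))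
    have h1 : contract (hess (S.x (i + (n + 1) + 1))) (S.x (i + (n + 1))) = 0 := by
      rwa [show i + (n + 1) + 1 = i + 1 + (n + 1) by omega]
    exact (parallel_hess h1).symm.contract_eq_zero h0 (contract_hess_self _)

end PointSeq

/-! ### The planes and hyperplanes spanned by consecutive points -/

lemma cross_dot_swap (x y z w : Fin 4 → ℤ) : cross x y z ⬝ᵥ w = -(cross x y w ⬝ᵥ z) := by
  rw [dot_four, dot_four]
  simp only [cross, Matrix.cons_val_zero, Matrix.cons_val_one, Matrix.cons_val]
  ring

lemma cross_eq_zero_of_forall {x y z : Fin 4 → ℤ}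
    (h : ∀ R : Fin 4 → ℤ, R ⬝ᵥ x = 0 → R ⬝ᵥ y = 0 → R ⬝ᵥ z = 0) : cross x y z = 0 := by
  funext p
  have : cross x y z ⬝ᵥ Pi.single p 1 = 0 := by
    rw [cross_dot_swap, h _ (cross_dot_left _ _ _) (cross_dot_mid _ _ _), neg_zero]
  simpa using this

/-- The linear form obtained by composing `contract q` with the linear form `e`. -/
def contractForm (q : Fin 3 → ℤ) (e : Fin 2 → ℤ) : Fin 4 → ℤ :=
  ![e 0 * q 0, e 0 * q 1 + e 1 * q 0, e 0 * q 2 + e 1 * q 1, e 1 * q 2]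

lemma contractForm_dot (q : Fin 3 → ℤ) (e : Fin 2 → ℤ) (z : Fin 4 → ℤ) :
    contractForm q e ⬝ᵥ z = e 0 * contract q z 0 + e 1 * contract q z 1 := by
  rw [dot_four]
  simp [contractForm, contract]
  ring

namespace PointSeq

variable {ξ lam k : ℝ} (S : PointSeq ξ lam k)

/-- The normal vector of the hyperplane spanned by three consecutive points. -/
def normal (i : ℕ) : Fin 4 → ℤ := cross (S.x i) (S.x (i + 1)) (S.x (i + 2))

lemma normal_dot_zero (i : ℕ) : S.normal i ⬝ᵥ S.x i = 0 := cross_dot_left _ _ _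

lemma normal_dot_one (i : ℕ) : S.normal i ⬝ᵥ S.x (i + 1) = 0 := cross_dot_mid _ _ _

lemma normal_dot_two (i : ℕ) : S.normal i ⬝ᵥ S.x (i + 2) = 0 := cross_dot_right _ _ _

lemma dot_iff_of_normal_eq_zero (R : Fin 4 → ℤ) {a b : ℕ} (hab : a ≤ b)
    (h : ∀ i, a ≤ i → i < b → S.normal i = 0) :
    (R ⬝ᵥ S.x a = 0 ∧ R ⬝ᵥ S.x (a + 1) = 0) ↔ (R ⬝ᵥ S.x b = 0 ∧ R ⬝ᵥ S.x (b + 1) = 0) := by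
  induction b, hab using Nat.le_induction with
  | base => rfl
  | succ b hab ih =>
    have hb : cross (S.x b) (S.x (b + 1)) (S.x (b + 2)) = 0 := h b hab b.lt_succ_self
    rw [ih fun i hi hib => h i hi (hib.trans b.lt_succ_self)]
    exact ⟨fun ⟨h0, h1⟩ => ⟨h1, dot_eq_zero_of_cross_eq_zero
        (S.not_parallel b.lt_succ_self) hb h0 h1⟩,
      fun ⟨h0, h1⟩ => ⟨dot_eq_zero_of_cross_eq_zero
        (S.not_parallel (b + 1).lt_succ_self) (cross_rotate hb) h0 h1, h0⟩⟩

lemma infinite_normal_ne_zero : {i | S.normal i ≠ 0}.Infinite := fun hfin => by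
  obtain ⟨n, hn⟩ := hfin.bddAbove
  have hz : ∀ i, n + 1 ≤ i → S.normal i = 0 := fun i hi => by
    by_contra hne
    have := hn hne
    omega
  obtain ⟨R, hR, h0, h1⟩ := exists_ne_zero_dot_eq_zero (S.not_parallel (n + 1).lt_succ_self)
  obtain ⟨m, hm⟩ := S.exists_forall_dot_ne_zero hR
  exact hm (n + 1 + m) (by omega) ((S.dot_iff_of_normal_eq_zero R (Nat.le_add_right (n + 1) m)
    fun i hi _ => hz i hi).1 ⟨h0, h1⟩).1

lemma exists_normal_subseq : ∃ f : ℕ → ℕ, StrictMono f ∧ (∀ n, S.normal (f n) ≠ 0) ∧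
    ∀ n i, f n < i → i < f (n + 1) → S.normal i = 0 := by
  classical
  have hinf := S.infinite_normal_ne_zero
  refine ⟨Nat.nth fun i => S.normal i ≠ 0, Nat.nth_strictMono hinf,
    fun n => Nat.nth_mem_of_infinite hinf n, fun n i h1 h2 => ?_⟩
  by_contra h
  rw [← Nat.nth_count (p := fun i => S.normal i ≠ 0) h, Nat.nth_lt_nth hinf] at h1 h2
  omega

lemma pairing_parallel {i j : ℕ} (hij : i < j)
    (h : ∀ R : Fin 4 → ℤ, R ⬝ᵥ S.x i = 0 → R ⬝ᵥ S.x (i + 1) = 0 → R ⬝ᵥ S.x j = 0)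
    (hp : pairing (S.x i) (S.x (i + 1)) ≠ 0) :
    Parallel (pairing (S.x i) (S.x j)) (pairing (S.x i) (S.x (i + 1))) ∧
      pairing (S.x i) (S.x j) ≠ 0 := by
  have hself : ∀ p, contract (hess (S.x i)) (S.x i) p = 0 :=
    fun p => congrFun (contract_hess_self (S.x i)) p
  constructor
  · have h0 := h (contractForm (hess (S.x i)) ![pairing (S.x i) (S.x (i + 1)) 1,
      -pairing (S.x i) (S.x (i + 1)) 0]) (by rw [contractForm_dot, hself, hself]; simp)
      (by rw [contractForm_dot]; simp [pairing]; ring)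
    rw [contractForm_dot] at h0
    change pairing (S.x i) (S.x (i + 1)) 1 * pairing (S.x i) (S.x j) 0
      + -pairing (S.x i) (S.x (i + 1)) 0 * pairing (S.x i) (S.x j) 1 = 0 at h0
    intro p q
    fin_cases p <;> fin_cases q <;> simp <;> linarith
  · intro h0
    refine hp (funext fun p => ?_)
    have hz : ∀ p, contract (hess (S.x i)) (S.x j) p = 0 := fun p => congrFun h0 p
    have h1 := dot_eq_zero_of_cross_eq_zero (R := contractForm (hess (S.x i)) (Pi.single p 1))
      (S.not_parallel_of_ne hij.ne') (cross_rotate (cross_rotate (cross_eq_zero_of_forall h)))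
      (by rw [contractForm_dot, hz, hz]; simp) (by rw [contractForm_dot, hself, hself]; simp)
    rw [contractForm_dot] at h1
    fin_cases p
    · simpa [pairing] using h1
    · simpa [pairing] using h1

section Subsequence

variable {f : ℕ → ℕ}

lemma dot_iff_subseq (hf : StrictMono f)
    (hz : ∀ n i, f n < i → i < f (n + 1) → S.normal i = 0) (R : Fin 4 → ℤ) (n : ℕ) :
    (R ⬝ᵥ S.x (f n + 1) = 0 ∧ R ⬝ᵥ S.x (f n + 2) = 0) ↔
      (R ⬝ᵥ S.x (f (n + 1)) = 0 ∧ R ⬝ᵥ S.x (f (n + 1) + 1) = 0) :=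
  S.dot_iff_of_normal_eq_zero R (hf n.lt_succ_self) fun i => hz n i

lemma parallel_normal_succ (hf : StrictMono f)
    (hz : ∀ n i, f n < i → i < f (n + 1) → S.normal i = 0) {n : ℕ}
    (h : S.normal (f n) ⬝ᵥ S.x (f (n + 1) + 2) = 0) :
    Parallel (S.normal (f (n + 1))) (S.normal (f n)) := by
  obtain ⟨h0, h1⟩ := (S.dot_iff_subseq hf hz _ n).1 ⟨S.normal_dot_one _, S.normal_dot_two _⟩
  exact parallel_cross h0 h1 h

/-- Three consecutive hyperplanes, of which the first two coincide, are all equal. -/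
lemma dot_eq_zero_of_dot_eq_zero (hf : StrictMono f) (hne : ∀ n, S.normal (f n) ≠ 0)
    (hz : ∀ n i, f n < i → i < f (n + 1) → S.normal i = 0)
    (hp : ∀ i, pairing (S.x (i + 1)) (S.x i) ≠ 0)
    (hlam : (1 - 2 * lam) ^ 2 = (lam * (1 - lam) - (1 - 2 * lam)) * (lam * (1 - lam))) {n : ℕ}
    (h : S.normal (f n) ⬝ᵥ S.x (f (n + 1) + 2) = 0) :
    S.normal (f n) ⬝ᵥ S.x (f (n + 2) + 2) = 0 := by
  by_contra hcon
  have hpar := S.parallel_normal_succ hf hz h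
  obtain ⟨h0, h1⟩ := (S.dot_iff_subseq hf hz _ (n + 1)).1
    ⟨S.normal_dot_one _, S.normal_dot_two _⟩
  have hD := S.pos_of_dot_succ_ne_zero (a := f n) (b := f (n + 2) + 1)
    (hpar.symm.dot_eq_zero (hne _) h1) hcon
  have hE := S.pos_of_dot_ne_zero (b := f (n + 2)) (d := f (n + 1))
    ((hf.monotone (n + 1).le_succ).trans (Nat.le_succ _)) fun h2 => hcon (by
      obtain ⟨h3, h4⟩ := (S.dot_iff_subseq hf hz _ (n + 1)).2
        ⟨S.normal_dot_zero (f (n + 2)), S.normal_dot_one (f (n + 2))⟩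
      have h5 : Parallel (S.normal (f (n + 1))) (S.normal (f (n + 2))) := parallel_cross h2 h3 h4
      exact (hpar.symm.trans (hne _) h5).dot_eq_zero (hne _) (S.normal_dot_two _))
  have hA := S.lt_of_pairing_ne_zero (hp (f n))
  have hB := S.lt_of_pairing_ne_zero (hp (f (n + 2)))
  have hd : S.t (f n + 2) ≤ S.t (f (n + 1) + 1) :=
    S.t_le (Nat.succ_le_succ (hf n.lt_succ_self))
  have l1 := S.le_lam
  have l2 := S.lam_lt
  have hv : 0 < 1 - 2 * lam := by linarith
  have huv : 0 < lam * (1 - lam) - (1 - 2 * lam) := by nlinarith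
  change 0 < (1 - lam) * S.t (f n + 2) - lam * S.t (f n + 1)
    + (1 - lam) * S.t (f (n + 2) + 2) - S.t (f (n + 2) + 1) at hD
  set A := S.t (f n + 2)
  set A' := S.t (f n + 1)
  set B := S.t (f (n + 2) + 2)
  set B' := S.t (f (n + 2) + 1)
  have e1 : 0 < A * (1 - 2 * lam) - B * (lam * (1 - lam) - (1 - 2 * lam)) := by
    have m1 := mul_pos (by linarith : 0 < 1 - lam) hD
    have m2 := mul_pos (by linarith : 0 < lam) (sub_pos.2 hA)
    linarith
  have e2 : 0 < B * (1 - 2 * lam) - A * (lam * (1 - lam)) := by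
    have m1 := mul_pos (by linarith : 0 < 1 - lam) hE
    have m2 := mul_pos (by linarith : 0 < lam) (sub_pos.2 hB)
    have m3 := mul_nonneg (mul_nonneg (by linarith : 0 ≤ lam) (by linarith : 0 ≤ 1 - lam))
      (sub_nonneg.2 hd)
    linarith
  have m1 := mul_pos hv e1
  have m2 := mul_pos huv e2
  have m3 := congrArg (A * ·) hlam
  linarith

lemma normal_dot_ne_zero (hf : StrictMono f) (hne : ∀ n, S.normal (f n) ≠ 0)
    (hz : ∀ n i, f n < i → i < f (n + 1) → S.normal i = 0)
    (hp : ∀ i, pairing (S.x (i + 1)) (S.x i) ≠ 0)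
    (hlam : (1 - 2 * lam) ^ 2 = (lam * (1 - lam) - (1 - 2 * lam)) * (lam * (1 - lam))) (n : ℕ) :
    S.normal (f n) ⬝ᵥ S.x (f (n + 1) + 2) ≠ 0 := fun h => by
  have key : ∀ m, S.normal (f (n + m)) ⬝ᵥ S.x (f (n + m + 1) + 2) = 0 ∧
      Parallel (S.normal (f n)) (S.normal (f (n + m))) := fun m => by
    induction m with
    | zero => exact ⟨h, fun p q => mul_comm _ _⟩
    | succ m ih =>
      have hpar := S.parallel_normal_succ hf hz ih.1
      exact ⟨hpar.dot_eq_zero (hne _) (S.dot_eq_zero_of_dot_eq_zero hf hne hz hp hlam ih.1),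
        ih.2.trans (hne _) hpar.symm⟩
  obtain ⟨m, hm⟩ := S.exists_forall_dot_ne_zero (hne n)
  exact hm (f (n + m)) ((Nat.le_add_left m n).trans hf.le_apply)
    ((key m).2.dot_eq_zero (hne _) (S.normal_dot_zero _))

end Subsequence

/-- No sequence of minimal points with non-vanishing consecutive pairings exists at the critical
exponent. -/
theorem false_of_nondegenerate (S : PointSeq ξ lam k)
    (hp : ∀ i, pairing (S.x i) (S.x (i + 1)) ≠ 0) (hp' : ∀ i, pairing (S.x (i + 1)) (S.x i) ≠ 0)
    (hlam : (1 - 2 * lam) ^ 2 = (lam * (1 - lam) - (1 - 2 * lam)) * (lam * (1 - lam))) :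
    False := by
  obtain ⟨f, hf, hne, hz⟩ := S.exists_normal_subseq
  have hnd := S.normal_dot_ne_zero hf hne hz hp' hlam
  set s : ℕ → ℝ := fun n => S.t (f n + 1) with hs
  set u : ℕ → ℝ := fun n => S.t (f n + 2) with hu
  have hlt : ∀ n, f n < f (n + 1) := fun n => hf n.lt_succ_self
  have hsu : ∀ n, u n ≤ s (n + 1) := fun n => S.t_le (Nat.succ_le_succ (hlt n))
  have hs0 : ∀ n, 0 ≤ s n := fun n => S.t_nonneg _
  have hu0 : ∀ n, 0 ≤ u n := fun n => S.t_nonneg _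
  have hls : ∀ n, 0.4245 * s n ≤ lam * s n := fun n => mul_le_mul_of_nonneg_right S.le_lam (hs0 n)
  have hlu : ∀ n, 0.4245 * u n ≤ lam * u n := fun n => mul_le_mul_of_nonneg_right S.le_lam (hu0 n)
  have hC : ∀ n, lam * u n < (1 - lam) * s n := fun n => S.lt_of_pairing_ne_zero (hp' (f n))
  have hD : ∀ n, 0 < (1 - lam) * u n - lam * s n + (1 - lam) * u (n + 1) - s (n + 1) := fun n =>
    S.pos_of_dot_succ_ne_zero (a := f n) (b := f (n + 1) + 1)
      ((S.dot_iff_subseq hf hz _ n).1 ⟨S.normal_dot_one _, S.normal_dot_two _⟩).2 (hnd n)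
  have hsu' : ∀ n, s (n + 1) ≤ 0.7803 * u (n + 1) := fun n => by
    linarith [hsu n, hls n, hlu n, hC n, hD n, hlu (n + 1), hu0 n, hu0 (n + 1)]
  have hpar : ∀ n, Parallel (pairing (S.x (f n + 1)) (S.x (f (n + 1) + 1)))
      (pairing (S.x (f n + 1)) (S.x (f n + 2))) ∧
      pairing (S.x (f n + 1)) (S.x (f (n + 1) + 1)) ≠ 0 := fun n =>
    S.pairing_parallel (Nat.succ_lt_succ (hlt n))
      (fun R h0 h1 => ((S.dot_iff_subseq hf hz R n).1 ⟨h0, h1⟩).2) (hp _)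
  have hdd : ∀ n, Parallel (pairing (S.x (f (n + 1) + 1)) (S.x (f (n + 1) + 2)))
      (pairing (S.x (f (n + 2) + 1)) (S.x (f (n + 2) + 2))) := fun n => by
    by_contra hcon
    rcases S.lt_or_lt_of_not_parallel hcon (hpar (n + 1)).1 (hpar (n + 1)).2 (hpar (n + 2)).1
      (hpar (n + 2)).2 with h | h
    · change 3 * lam * u (n + 2) + lam * u (n + 1) < u (n + 2) + s (n + 1) at h
      linarith [hsu' n, hD (n + 1), hsu (n + 1), hlu (n + 1), hlu (n + 2), hls (n + 1),
        hu0 (n + 1), hu0 (n + 2)]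
    · change 2 * lam * u (n + 1) + lam * u (n + 2) + lam * u (n + 3) < u (n + 1) + s (n + 2) at h
      linarith [hsu' (n + 1), hsu' (n + 2), hsu (n + 1), hsu (n + 2), hlu (n + 1), hlu (n + 2),
        hlu (n + 3), hu0 (n + 1), hu0 (n + 2)]
  obtain ⟨g, Q, c, hg, hQ, hc⟩ := exists_primitive (hp (f 1 + 1))
  have hdQ : ∀ n, Parallel (pairing (S.x (f (n + 1) + 1)) (S.x (f (n + 1) + 2))) Q := fun n => by
    induction n with
    | zero => exact Parallel.of_eq_mul hQ
    | succ n ih => exact (hdd n).symm.trans (hp _) ih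
  have hQ0 : Q ≠ 0 := fun h0 => by simp [h0] at hc
  have hlow : ∀ n, |ξ * Q 0 - Q 1| ≤ Real.exp (-(0.18 * u (n + 1))) := fun n => by
    have hE := ((hpar (n + 1)).1.trans (hp _) (hdQ n)).eq_mul hc
    have h1 := (abs_eval_le_of_eq_mul (ξ := ξ) (fun h0 => (hpar (n + 1)).2 (funext fun p => by
      rw [hE p, h0, zero_mul]; rfl)) hE).trans (S.abs_pairing_le _ _)
    refine h1.trans ?_
    have hK := S.powBound_le_exp (C := 30) (by norm_num)
    refine (mul_le_mul_of_nonneg_right hK (Real.exp_pos _).le).trans ?_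
    rw [← Real.exp_add, Real.exp_le_exp]
    have k1 : lam * u (n + 1) + 3 * k ≤ S.l (f (n + 1) + 1) := S.le_l _
    have k2 : lam * u (n + 2) + 3 * k ≤ S.l (f (n + 2) + 1) := S.le_l _
    change k + (s (n + 1) - S.l (f (n + 1) + 1) - S.l (f (n + 2) + 1)) ≤ _
    linarith [S.k_pos, hsu' n, hsu' (n + 1), hsu (n + 1), hlu (n + 1), hlu (n + 2), hu0 (n + 1),
      hu0 (n + 2)]
  have hpos : 0 < |ξ * Q 0 - Q 1| := by
    refine abs_pos.2 fun h0 => form_ne_zero S.indep (R := ![-Q 1, Q 0, 0, 0]) (fun h1 => hQ0 ?_) ?_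
    · have e0 : Q 0 = 0 := by simpa using congrFun h1 1
      have e1 : Q 1 = 0 := by simpa using congrFun h1 0
      funext p
      fin_cases p
      · exact e0
      · exact e1
    · simp
      linarith
  obtain ⟨m, hm⟩ := S.exists_lt_exp_t (Real.exp (-Real.log |ξ * Q 0 - Q 1| / 0.18))
  have h1 : -Real.log |ξ * Q 0 - Q 1| / 0.18 < u (m + 1) := Real.exp_lt_exp.1
    (hm (f (m + 1) + 2) ((m.le_succ.trans hf.le_apply).trans (Nat.le_add_right _ 2)))
  have h2 := (Real.log_le_iff_le_exp hpos).2 (hlow m)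
  rw [div_lt_iff₀ (by norm_num)] at h1
  linarith

end PointSeq

lemma lambda3_eq : lambda3 = (2 + √5 - √(7 + 2 * √5)) / 2 := by
  have h5 : √5 ^ 2 = 5 := Real.sq_sqrt (by norm_num)
  have h2 : gold ^ 2 = gold + 1 := by unfold gold; linarith
  have h3 : gold ^ 3 = 2 + √5 := by
    rw [pow_succ, h2, add_mul, one_mul, ← sq, h2]; unfold gold; ring
  have h6 : gold ^ 6 - 4 * gold = 7 + 2 * √5 := by
    rw [show gold ^ 6 = (gold ^ 3) ^ 2 by ring, h3]; unfold gold; linarith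
  rw [lambda3, h3, h6]

lemma le_lambda3 : 0.4245 ≤ lambda3 := by
  have h5 : √5 ^ 2 = 5 := Real.sq_sqrt (by norm_num)
  have h : 2.236 ≤ √5 := Real.le_sqrt_of_sq_le (by norm_num)
  have : √(7 + 2 * √5) ≤ 1.151 + √5 := Real.sqrt_le_iff.2 ⟨by linarith, by linarith⟩
  rw [lambda3_eq]; linarith

lemma lambda3_lt_half : lambda3 < 1 / 2 := by
  have h5 : √5 ^ 2 = 5 := Real.sq_sqrt (by norm_num)
  have : 1 + √5 < √(7 + 2 * √5) := Real.lt_sqrt_of_sq_lt (by linarith)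
  rw [lambda3_eq]; linarith

lemma lambda3_mul_one_sub : lambda3 * (1 - lambda3) = gold * (1 - 2 * lambda3) := by
  have h5 : √5 ^ 2 = 5 := Real.sq_sqrt (by norm_num)
  have h7 : √(7 + 2 * √5) ^ 2 = 7 + 2 * √5 := Real.sq_sqrt (by positivity)
  rw [lambda3_eq, gold]; linear_combination -h7 / 4 + h5 / 4

/-- A polynomial equation with rational coefficients satisfied by `lambda3`. -/
lemma lambda3_quartic : (1 - 2 * lambda3) ^ 2 =
    (lambda3 * (1 - lambda3) - (1 - 2 * lambda3)) * (lambda3 * (1 - lambda3)) := by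
  have h5 : √5 ^ 2 = 5 := Real.sq_sqrt (by norm_num)
  have h2 : gold ^ 2 = gold + 1 := by unfold gold; linarith
  rw [lambda3_mul_one_sub]
  linear_combination -(1 - 2 * lambda3) ^ 2 * h2

/-- Decreasing the exponent makes room for an arbitrarily small constant. -/
lemma ApproxHyp.of_lt {ξ c c' lam mu : ℝ} (hc' : 0 < c') (hmu : mu < lam)
    (h : ApproxHyp ξ c lam) : ApproxHyp ξ c' mu := by
  obtain ⟨X₀, hX₀⟩ := h
  have ht : Filter.Tendsto (fun X : ℝ => c * X ^ (-(lam - mu))) Filter.atTop (nhds (c * 0)) :=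
    (tendsto_rpow_neg_atTop (sub_pos.2 hmu)).const_mul c
  obtain ⟨X₁, hX₁⟩ := Filter.eventually_atTop.1 (ht.eventually_le_const (by simpa using hc'))
  refine ⟨max (max X₀ X₁) 1, fun X hX => ?_⟩
  obtain ⟨⟨h0, h1⟩, hpos⟩ : (X₀ ≤ X ∧ X₁ ≤ X) ∧ 1 ≤ X := by simpa using hX
  obtain ⟨x, hx, hx0, hxi⟩ := hX₀ X h0
  refine ⟨x, hx, hx0, fun i hi => (hxi i hi).trans ?_⟩
  have hX0 : 0 < X := by linarith
  calc c * X ^ (-lam) = c * X ^ (-(lam - mu)) * X ^ (-mu) := by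
        rw [mul_assoc, ← Real.rpow_add hX0]; ring_nf
    _ ≤ c' * X ^ (-mu) := mul_le_mul_of_nonneg_right (hX₁ X h1) (Real.rpow_nonneg hX0.le _)

/-- At the critical exponent the constant is bounded below in terms of `ξ` only. -/
lemma exists_le_of_approxHyp_lambda3 {ξ : ℝ}
    (hξ : LinearIndependent ℚ ![(1 : ℝ), ξ, ξ ^ 2, ξ ^ 3]) :
    ∃ c₀ : ℝ, 0 < c₀ ∧ ∀ c : ℝ, 0 < c → ApproxHyp ξ c lambda3 → c₀ ≤ c := by
  refine ⟨Real.exp (-(3 * (1000 * powBound ξ ^ 2))) / 2, by positivity, fun c hc h => ?_⟩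
  by_contra! hlt
  obtain ⟨S⟩ := exists_pointSeq hξ le_lambda3 lambda3_lt_half hc
    (k := 1000 * powBound ξ ^ 2) (by linarith [Real.add_one_le_exp (1000 * powBound ξ ^ 2)])
    (by linarith) h
  obtain ⟨T, hT, hT'⟩ := S.exists_nondegenerate
  exact T.false_of_nondegenerate hT hT' lambda3_quartic

theorem statement0 (ξ : ℝ)
    (hξ : LinearIndependent ℚ ![(1 : ℝ), ξ, ξ ^ 2, ξ ^ 3]) :
    (∀ c lam : ℝ, 0 < c → 0 < lam → ApproxHyp ξ c lam → lam ≤ lambda3) ∧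
    (∃ c₀ : ℝ, 0 < c₀ ∧ ∀ c : ℝ, 0 < c → ApproxHyp ξ c lambda3 → c₀ ≤ c) := by
  obtain ⟨c₀, hc₀, hmin⟩ := exists_le_of_approxHyp_lambda3 hξ
  refine ⟨fun c lam _ _ h => ?_, c₀, hc₀, hmin⟩
  by_contra! hlt
  linarith [hmin (c₀ / 2) (half_pos hc₀) (h.of_lt (half_pos hc₀) hlt)]
end
end

section
/- Let ξ ∈ ℝ and let n ≥ 1 be an integer. For any points y₀, …, y_n ∈ ℝ^{n+1}, writing y_{i,0} for the first coordinate of y_i, one has det(y₀,…,y_n) = Σ_{i=0}^{n} (−1)^i y_{i,0} det(Δy₀, …, Δy_{i-1}, Δy_{i+1}, …, Δy_n), where the i-th argument Δy_i is omitted from the determinant on the right-hand side. -/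
noncomputable section

/-- Δ operator: for y ∈ ℝ^{n+1}, Δy = y⁺ − ξ y⁻ ∈ ℝⁿ. -/
def DeltaG (ξ : ℝ) {n : ℕ} (y : Fin (n + 1) → ℝ) : Fin n → ℝ :=
  fun i => y i.succ - ξ * y i.castSucc

theorem statement2 (ξ : ℝ) (n : ℕ) (hn : 1 ≤ n)
    (y : Fin (n + 1) → Fin (n + 1) → ℝ) :
    Matrix.det (Matrix.of y) =
      ∑ i : Fin (n + 1), (-1 : ℝ) ^ (i : ℕ) * y i 0 *
        Matrix.det (Matrix.of fun j : Fin n => DeltaG ξ (y (i.succAbove j))) := by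
  rw [Matrix.det_eq_of_forall_col_eq_smul_add_pred
      (B := Matrix.of fun i => Fin.cons (y i 0) (DeltaG ξ (y i))) (fun _ => ξ)
      (fun i => by simp) (fun i j => by simp [DeltaG]),
    Matrix.det_succ_column_zero]
  rfl
end
end

section
/- Let ξ ∈ ℝ and let n ∈ {1,2,3}. There exist positive constants δ, c₁, c₂ depending only on ξ with the following property: if y₀, …, y_n are linearly independent points of ℤ^{n+1} such that L(y_n) < 1 and such that for each i = 0, …, n−1 the product ‖y_i‖ · L(y₀)⋯L(y_{i−1})·L(y_{i+1})⋯L(y_n) (the factor L(y_i) being omitted) is smaller than δ, then c₁ ‖y_n‖ |det(Δy₀,…,Δy_{n−1})| ≤ |det(y₀,…,y_n)| ≤ c₂ ‖y_n‖ |det(Δy₀,…,Δy_{n−1})|. -/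
noncomputable section

/-- Sup norm of a vector. -/
def vnormG {n : ℕ} (x : Fin n → ℝ) : ℝ := ⨆ i, |x i|

/-- L(x) = max_{1≤i≤n} |x₀ξⁱ − x_i| for x ∈ ℝ^{n+1}. -/
def LG (ξ : ℝ) {n : ℕ} (x : Fin (n + 1) → ℝ) : ℝ :=
  ⨆ i : Fin n, |x 0 * ξ ^ ((i : ℕ) + 1) - x i.succ|

/-- A determinant is bounded by the products of bounds for its rows. -/
lemma abs_det_le_factorial_mul_prod {n : ℕ} (A : Matrix (Fin n) (Fin n) ℝ) (b : Fin n → ℝ)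
    (h : ∀ i j, |A i j| ≤ b i) : |A.det| ≤ (n.factorial : ℝ) * ∏ i, b i := by
  rw [Matrix.det_apply]
  refine (Finset.abs_sum_le_sum_abs _ _).trans ?_
  have hterm : ∀ σ ∈ (Finset.univ : Finset (Equiv.Perm (Fin n))),
      |Equiv.Perm.sign σ • ∏ i, A (σ i) i| ≤ ∏ i, b i := by
    intro σ _
    have habs : |Equiv.Perm.sign σ • ∏ i, A (σ i) i| = ∏ i, |A (σ i) i| := by
      rw [← Finset.abs_prod]
      rcases Int.units_eq_one_or (Equiv.Perm.sign σ) with hs | hs <;> simp [hs]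
    rw [habs, ← Equiv.prod_comp σ b]
    exact Finset.prod_le_prod (fun _ _ => abs_nonneg _) fun i _ => h (σ i) i
  refine (Finset.sum_le_sum hterm).trans ?_
  simp [Fintype.card_perm]

lemma abs_le_vnormG {n : ℕ} (x : Fin n → ℝ) (i : Fin n) : |x i| ≤ vnormG x :=
  le_ciSup (f := fun i => |x i|) (Set.finite_range _).bddAbove i

lemma abs_sub_le_LG (ξ : ℝ) {n : ℕ} (x : Fin (n + 1) → ℝ) (i : Fin n) :
    |x 0 * ξ ^ ((i : ℕ) + 1) - x i.succ| ≤ LG ξ x :=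
  le_ciSup (f := fun i : Fin n => |x 0 * ξ ^ ((i : ℕ) + 1) - x i.succ|)
    (Set.finite_range _).bddAbove i

lemma LG_nonneg (ξ : ℝ) {n : ℕ} (x : Fin (n + 1) → ℝ) : 0 ≤ LG ξ x :=
  Real.iSup_nonneg fun _ => abs_nonneg _

lemma abs_pow_sub_le_LG (ξ : ℝ) {n : ℕ} (x : Fin (n + 1) → ℝ) (i : Fin (n + 1)) :
    |x 0 * ξ ^ (i : ℕ) - x i| ≤ LG ξ x := by
  cases i using Fin.cases with
  | zero => simpa using LG_nonneg ξ x
  | succ i => simpa using abs_sub_le_LG ξ x i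

lemma abs_DeltaG_le (ξ : ℝ) {n : ℕ} (x : Fin (n + 1) → ℝ) (i : Fin n) :
    |DeltaG ξ x i| ≤ (1 + |ξ|) * LG ξ x := by
  have h1 := abs_sub_le_LG ξ x i
  have h2 := abs_pow_sub_le_LG ξ x i.castSucc
  have heq : DeltaG ξ x i = ξ * (x 0 * ξ ^ (i : ℕ) - x i.castSucc)
      - (x 0 * ξ ^ ((i : ℕ) + 1) - x i.succ) := by
    simp only [DeltaG]; ring
  rw [heq]
  refine (abs_sub _ _).trans ?_
  rw [abs_mul]
  have := mul_le_mul_of_nonneg_left h2 (abs_nonneg ξ)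
  simp only [Fin.val_castSucc] at this
  linarith

lemma prod_erase_eq_prod_succAbove {n : ℕ} (i : Fin (n + 1)) (f : Fin (n + 1) → ℝ) :
    ∏ j ∈ Finset.univ.erase i, f j = ∏ j, f (i.succAbove j) := by
  rw [← Finset.compl_singleton, ← Fin.image_succAbove_univ,
    Finset.prod_image fun _ _ _ _ h => Fin.succAbove_right_injective h]

/-- Subtracting `ξ` times each column from the next one and expanding along the first column. -/
lemma det_eq_sum_mul_det_DeltaG (ξ : ℝ) {n : ℕ} (y : Fin (n + 1) → Fin (n + 1) → ℝ) :
    Matrix.det (Matrix.of y) = ∑ i : Fin (n + 1), (-1) ^ (i : ℕ) * y i 0 *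
      Matrix.det (Matrix.of fun j : Fin n => DeltaG ξ (y (i.succAbove j))) := by
  have h : Matrix.det (Matrix.of y) =
      Matrix.det (Matrix.of fun i => (Fin.cons (y i 0) (DeltaG ξ (y i)) : Fin (n + 1) → ℝ)) := by
    refine Matrix.det_eq_of_forall_col_eq_smul_add_pred (fun _ => ξ) (fun i => by simp) ?_
    intro i j
    simp [DeltaG]
  rw [h, Matrix.det_succ_column_zero]
  refine Finset.sum_congr rfl fun i _ => ?_
  congr 1

lemma one_le_abs_det_of_int {n : ℕ} (y : Fin n → Fin n → ℝ)
    (hint : ∀ i k, ∃ a : ℤ, y i k = (a : ℝ)) (hli : LinearIndependent ℝ y) :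
    1 ≤ |Matrix.det (Matrix.of y)| := by
  choose a ha using hint
  have hdet : Matrix.det (Matrix.of y) = ((Matrix.det (Matrix.of a) : ℤ) : ℝ) := by
    rw [Int.cast_det]
    congr 1
    ext i k
    exact ha i k
  have hunit : IsUnit (Matrix.of y) := Matrix.linearIndependent_rows_iff_isUnit.mp hli
  have hne : Matrix.det (Matrix.of y) ≠ 0 := ((Matrix.isUnit_iff_isUnit_det _).mp hunit).ne_zero
  rw [hdet] at hne ⊢
  exact_mod_cast Int.one_le_abs (by exact_mod_cast hne)

lemma vnormG_le_of_LG_lt_one (ξ : ℝ) {n : ℕ} (x : Fin (n + 1) → ℝ) (hL : LG ξ x < 1)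
    (h0 : 1 ≤ |x 0|) : vnormG x ≤ (1 + (1 + |ξ|) ^ n) * |x 0| := by
  refine ciSup_le fun i => ?_
  have h := abs_pow_sub_le_LG ξ x i
  have hpow : |ξ| ^ (i : ℕ) ≤ (1 + |ξ|) ^ n :=
    (pow_le_pow_left₀ (abs_nonneg ξ) (by linarith) _).trans
      (pow_le_pow_right₀ (by linarith [abs_nonneg ξ]) (by omega))
  have h1 : |x i| ≤ |x 0 * ξ ^ (i : ℕ)| + |x 0 * ξ ^ (i : ℕ) - x i| := by
    have := abs_sub (x 0 * ξ ^ (i : ℕ)) (x 0 * ξ ^ (i : ℕ) - x i)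
    rwa [sub_sub_cancel] at this
  rw [abs_mul, abs_pow] at h1
  have h2 := mul_le_mul_of_nonneg_left hpow (abs_nonneg (x 0))
  linarith

/-- The determinant is its term coming from the last row up to a small error. -/
lemma abs_det_sub_last_term_le (ξ δ : ℝ) {n : ℕ} (y : Fin (n + 1) → Fin (n + 1) → ℝ)
    (hδ : ∀ i : Fin n, vnormG (y i.castSucc) *
      ∏ j ∈ Finset.univ.erase i.castSucc, LG ξ (y j) < δ) :
    |Matrix.det (Matrix.of y) - (-1) ^ n * y (Fin.last n) 0 *
      Matrix.det (Matrix.of fun j : Fin n => DeltaG ξ (y j.castSucc))| ≤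
      n * (n.factorial * (1 + |ξ|) ^ n * δ) := by
  rw [det_eq_sum_mul_det_DeltaG ξ y, Fin.sum_univ_castSucc]
  simp only [Fin.succAbove_last, Fin.val_last, add_sub_cancel_right]
  refine (Finset.abs_sum_le_sum_abs _ _).trans ?_
  have hterm : ∀ i ∈ (Finset.univ : Finset (Fin n)),
      |(-1) ^ (i.castSucc : ℕ) * y i.castSucc 0 *
        Matrix.det (Matrix.of fun j : Fin n => DeltaG ξ (y (i.castSucc.succAbove j)))| ≤
      n.factorial * (1 + |ξ|) ^ n * δ := by
    intro i _
    have hd := abs_det_le_factorial_mul_prod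
      (Matrix.of fun j : Fin n => DeltaG ξ (y (i.castSucc.succAbove j)))
      (fun j => (1 + |ξ|) * LG ξ (y (i.castSucc.succAbove j)))
      (fun j k => abs_DeltaG_le ξ _ k)
    rw [Finset.prod_mul_distrib, Finset.prod_const, Finset.card_univ, Fintype.card_fin,
      ← prod_erase_eq_prod_succAbove i.castSucc fun j => LG ξ (y j)] at hd
    have h0 := abs_le_vnormG (y i.castSucc) 0
    rw [abs_mul, abs_mul, abs_pow, abs_neg, abs_one, one_pow, one_mul]
    refine (mul_le_mul h0 hd (abs_nonneg _) ((abs_nonneg _).trans h0)).trans ?_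
    have hK : (0 : ℝ) ≤ n.factorial * (1 + |ξ|) ^ n := by positivity
    have := mul_le_mul_of_nonneg_left (hδ i).le hK
    linarith
  refine (Finset.sum_le_sum hterm).trans ?_
  simp

/-- Statement 3, with n = m + 1 ∈ {1,2,3} (so m ≤ 2) and points in ℝ^{n+1} = ℝ^{m+2}. -/
theorem statement3 (ξ : ℝ) (m : ℕ) (hm : m ≤ 2) :
    ∃ δ c₁ c₂ : ℝ, 0 < δ ∧ 0 < c₁ ∧ 0 < c₂ ∧
      ∀ y : Fin (m + 2) → Fin (m + 2) → ℝ,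
        (∀ i k, ∃ a : ℤ, y i k = (a : ℝ)) →
        LinearIndependent ℝ y →
        LG ξ (y (Fin.last (m + 1))) < 1 →
        (∀ i : Fin (m + 1),
          vnormG (y i.castSucc) *
            ∏ j ∈ Finset.univ.erase i.castSucc, LG ξ (y j) < δ) →
        c₁ * vnormG (y (Fin.last (m + 1))) *
            |Matrix.det (Matrix.of fun j : Fin (m + 1) => DeltaG ξ (y j.castSucc))|
          ≤ |Matrix.det (Matrix.of y)| ∧
        |Matrix.det (Matrix.of y)|
          ≤ c₂ * vnormG (y (Fin.last (m + 1))) *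
            |Matrix.det (Matrix.of fun j : Fin (m + 1) => DeltaG ξ (y j.castSucc))| := by
  have hK : (0 : ℝ) < (m + 1 : ℕ) * ((m + 1).factorial * (1 + |ξ|) ^ (m + 1)) := by positivity
  have hM : (0 : ℝ) < 1 + (1 + |ξ|) ^ (m + 1) := by positivity
  set K : ℝ := (m + 1 : ℕ) * ((m + 1).factorial * (1 + |ξ|) ^ (m + 1)) with hKdef
  set M : ℝ := 1 + (1 + |ξ|) ^ (m + 1) with hMdef
  refine ⟨1 / (2 * K), 2 / (3 * M), 2, by positivity, by positivity, two_pos, ?_⟩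
  intro y hint hli hL hδ
  have hone := one_le_abs_det_of_int y hint hli
  have herr := abs_det_sub_last_term_le ξ _ y hδ
  set D := Matrix.det (Matrix.of fun j : Fin (m + 1) => DeltaG ξ (y j.castSucc))
  set d := Matrix.det (Matrix.of y)
  have hhalf : ((m + 1 : ℕ) : ℝ) * ((m + 1).factorial * (1 + |ξ|) ^ (m + 1) * (1 / (2 * K)))
      = 1 / 2 := by
    rw [← mul_assoc, ← hKdef]
    field_simp
  rw [hhalf] at herr
  have hP : |(-1) ^ (m + 1) * y (Fin.last (m + 1)) 0 * D| = |y (Fin.last (m + 1)) 0| * |D| := by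
    simp [abs_mul]
  have hlower := (abs_sub_abs_le_abs_sub d _).trans herr
  have hupper := (abs_sub_abs_le_abs_sub _ d).trans ((abs_sub_comm _ _).trans_le herr)
  rw [hP] at hlower hupper
  have hx0 : 1 ≤ |y (Fin.last (m + 1)) 0| := by
    obtain ⟨a, ha⟩ := hint (Fin.last (m + 1)) 0
    have hne : y (Fin.last (m + 1)) 0 ≠ 0 := by
      intro h
      rw [h, abs_zero, zero_mul] at hlower
      linarith
    rw [ha] at hne ⊢
    exact_mod_cast Int.one_le_abs (by exact_mod_cast hne)
  have hv := mul_le_mul_of_nonneg_right (vnormG_le_of_LG_lt_one ξ _ hL hx0) (abs_nonneg D)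
  have hv' := mul_le_mul_of_nonneg_right (abs_le_vnormG (y (Fin.last (m + 1))) 0) (abs_nonneg D)
  constructor
  · rw [mul_assoc, div_mul_eq_mul_div, div_le_iff₀ (by positivity)]
    have := mul_le_mul_of_nonneg_left
      (show |y (Fin.last (m + 1)) 0| * |D| ≤ 3 / 2 * |d| by linarith) hM.le
    rw [← hMdef, mul_assoc] at hv
    linarith
  · rw [mul_assoc]
    linarith
end
end

section
/- Let ξ ∈ ℝ. For any x, y ∈ ℝ⁴ with x ≠ 0 and y ≠ 0, the point C(x,y) ∈ ℝ² is non-zero if and only if the subspace V(x) = span(x⁻, x⁺) of ℝ³ has dimension 2 and V(y) = span(y⁻, y⁺) is not contained in V(x). -/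
noncomputable section

/-- x⁻ = (x₀,x₁,x₂). -/
def vm (x : Fin 4 → ℝ) : Fin 3 → ℝ := ![x 0, x 1, x 2]

/-- x⁺ = (x₁,x₂,x₃). -/
def vp (x : Fin 4 → ℝ) : Fin 3 → ℝ := ![x 1, x 2, x 3]

/-- Determinant of the 3×3 matrix with rows a, b, c. -/
def det3 (a b c : Fin 3 → ℝ) : ℝ := Matrix.det (Matrix.of ![a, b, c])

/-- The map C(x,y) = (det(x⁻,x⁺,y⁻), det(x⁻,x⁺,y⁺)). -/
def Cmap (x y : Fin 4 → ℝ) : Fin 2 → ℝ :=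
  ![det3 (vm x) (vp x) (vm y), det3 (vm x) (vp x) (vp y)]

/-- V(x) = span(x⁻, x⁺) ⊆ ℝ³. -/
def Vsub (x : Fin 4 → ℝ) : Submodule ℝ (Fin 3 → ℝ) :=
  Submodule.span ℝ {vm x, vp x}

theorem det3_ne_zero_iff (a b c : Fin 3 → ℝ) :
    det3 a b c ≠ 0 ↔ LinearIndependent ℝ ![a, b] ∧ c ∉ Submodule.span ℝ {a, b} := by
  have hsnoc : (![a, b, c] : Fin 3 → Fin 3 → ℝ) = Fin.snoc ![a, b] c := by
    ext i j
    fin_cases i <;> rfl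
  have hli := Matrix.linearIndependent_rows_iff_isUnit (A := Matrix.of ![a, b, c])
  rw [Matrix.isUnit_iff_isUnit_det, isUnit_iff_ne_zero] at hli
  rw [det3, ← hli]
  change LinearIndependent ℝ ![a, b, c] ↔ _
  rw [hsnoc, linearIndependent_finSnoc,
    Matrix.range_cons_cons_empty]

theorem finrank_span_pair_eq_two_iff (a b : Fin 3 → ℝ) :
    Module.finrank ℝ (Submodule.span ℝ {a, b}) = 2 ↔ LinearIndependent ℝ ![a, b] := by
  rw [linearIndependent_iff_card_eq_finrank_span, Set.finrank, Matrix.range_cons_cons_empty,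
    Fintype.card_fin, eq_comm]

theorem statement5 (ξ : ℝ) (x y : Fin 4 → ℝ) (hx : x ≠ 0) (hy : y ≠ 0) :
    Cmap x y ≠ 0 ↔
      (Module.finrank ℝ (Vsub x) = 2 ∧ ¬ Vsub y ≤ Vsub x) := by
  have hC : Cmap x y ≠ 0 ↔
      det3 (vm x) (vp x) (vm y) ≠ 0 ∨ det3 (vm x) (vp x) (vp y) ≠ 0 := by
    simp [Cmap, or_iff_not_imp_left]
  have hV : Vsub y ≤ Vsub x ↔ vm y ∈ Vsub x ∧ vp y ∈ Vsub x := by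
    rw [Vsub, Submodule.span_le, Set.pair_subset_iff]
    rfl
  rw [hC, hV, det3_ne_zero_iff, det3_ne_zero_iff, ← and_or_left, ← not_and_or,
    ← finrank_span_pair_eq_two_iff]
  rfl
end
end

section
/- Let ξ ∈ ℝ. The trilinear map E : (ℝ⁴)³ → ℝ² defined by E(w,x,y) = (det(w⁻,x⁺,y⁻) − det(w⁺,x⁻,y⁻), det(w⁻,x⁺,y⁺) − det(w⁺,x⁻,y⁺)) satisfies, for all w, x, y ∈ ℝ⁴: E(w,x,y) = E(x,w,y), E(x,x,y) = 2C(x,y), and E(x,y,y) = E(y,x,y) = −C(y,x). -/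
noncomputable section

/-- The trilinear map E. -/
def Emap (w x y : Fin 4 → ℝ) : Fin 2 → ℝ :=
  ![det3 (vm w) (vp x) (vm y) - det3 (vp w) (vm x) (vm y),
    det3 (vm w) (vp x) (vp y) - det3 (vp w) (vm x) (vp y)]

theorem det3_eq (a b c : Fin 3 → ℝ) :
    det3 a b c = a 0 * b 1 * c 2 - a 0 * b 2 * c 1 - a 1 * b 0 * c 2 + a 1 * b 2 * c 0 +
      a 2 * b 0 * c 1 - a 2 * b 1 * c 0 := by
  simp [det3, Matrix.det_fin_three]

/-- Interchanging the first two rows changes the sign. -/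
theorem det3_swap (a b c : Fin 3 → ℝ) : det3 b a c = -det3 a b c := by
  simp only [det3_eq]
  ring

/-- Cyclically permuting the rows preserves the determinant. -/
theorem det3_rotate (a b c : Fin 3 → ℝ) : det3 b c a = det3 a b c := by
  simp only [det3_eq]
  ring

theorem det3_self_right (a b : Fin 3 → ℝ) : det3 a b b = 0 := by
  simp only [det3_eq]
  ring

theorem Emap_comm (w x y : Fin 4 → ℝ) : Emap w x y = Emap x w y := by
  simp only [Emap, det3_swap (vm x) (vp w), det3_swap (vm w) (vp x), sub_neg_eq_add, add_comm]

theorem Emap_self_left (x y : Fin 4 → ℝ) : Emap x x y = (2 : ℝ) • Cmap x y := by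
  ext i
  fin_cases i <;> simp [Emap, Cmap, det3_swap (vm x) (vp x)] <;> ring

theorem Emap_self_right (x y : Fin 4 → ℝ) : Emap x y y = -Cmap y x := by
  ext i
  fin_cases i
  · simp [Emap, Cmap, det3_self_right, ← det3_rotate (vm x), det3_swap (vm y) (vp y)]
  · simp [Emap, Cmap, det3_self_right, ← det3_rotate (vp x)]

theorem statement6 (ξ : ℝ) (w x y : Fin 4 → ℝ) :
    Emap w x y = Emap x w y ∧
    Emap x x y = (2 : ℝ) • Cmap x y ∧
    Emap x y y = -Cmap y x ∧
    Emap y x y = -Cmap y x := by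
  exact ⟨Emap_comm w x y, Emap_self_left x y, Emap_self_right x y,
    (Emap_comm y x y).trans (Emap_self_right x y)⟩
end
end

section
/- Let ξ ∈ ℝ. There exists a constant κ > 0 depending only on ξ such that for all x, y ∈ ℝ⁴: ‖C(x,y)‖ ≤ κ(‖x‖L(x)L(y) + ‖y‖L(x)²) and L(C(x,y)) ≤ κ‖x‖L(x)L(y). -/
noncomputable section

/-- ‖x‖ = max of the absolute values of the coordinates. -/
def norm4 (x : Fin 4 → ℝ) : ℝ := max (max |x 0| |x 1|) (max |x 2| |x 3|)

/-- L(x) = max_{1≤i≤3}|x₀ξⁱ − x_i|. -/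
def L4 (ξ : ℝ) (x : Fin 4 → ℝ) : ℝ :=
  max (max |x 0 * ξ - x 1| |x 0 * ξ ^ 2 - x 2|) |x 0 * ξ ^ 3 - x 3|

/-- Bound for a 3×3 determinant in terms of the first entries of its rows and of their deviations
from the direction `(1, ξ, ξ²)`. -/
lemma abs_det3_le (ξ N P S T : ℝ) (a b c : Fin 3 → ℝ)
    (ha : |a 0| ≤ N) (hb : |b 0| ≤ N) (hc : |c 0| ≤ P)
    (ha₁ : |a 0 * ξ - a 1| ≤ S) (ha₂ : |a 0 * ξ ^ 2 - a 2| ≤ S)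
    (hb₁ : |b 0 * ξ - b 1| ≤ S) (hb₂ : |b 0 * ξ ^ 2 - b 2| ≤ S)
    (hc₁ : |c 0 * ξ - c 1| ≤ T) (hc₂ : |c 0 * ξ ^ 2 - c 2| ≤ T) :
    |det3 a b c| ≤ 4 * (N * S * T) + 2 * (P * S ^ 2) := by
  have expand : det3 a b c =
      a 0 * ((b 0 * ξ - b 1) * (c 0 * ξ ^ 2 - c 2) - (b 0 * ξ ^ 2 - b 2) * (c 0 * ξ - c 1))
      - b 0 * ((a 0 * ξ - a 1) * (c 0 * ξ ^ 2 - c 2) - (a 0 * ξ ^ 2 - a 2) * (c 0 * ξ - c 1))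
      + c 0 * ((a 0 * ξ - a 1) * (b 0 * ξ ^ 2 - b 2)
        - (a 0 * ξ ^ 2 - a 2) * (b 0 * ξ - b 1)) := by
    simp [det3, Matrix.det_fin_three]
    ring
  have term (p q r s t A B D : ℝ) (hp : |p| ≤ A) (hq : |q| ≤ B) (hr : |r| ≤ D)
      (hs : |s| ≤ B) (ht : |t| ≤ D) : |p * (q * r - s * t)| ≤ A * (2 * (B * D)) := by
    have hA : 0 ≤ A := (abs_nonneg p).trans hp
    have hB : 0 ≤ B := (abs_nonneg q).trans hq
    have hqr : |q * r| ≤ B * D := by rw [abs_mul]; gcongr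
    have hst : |s * t| ≤ B * D := by rw [abs_mul]; gcongr
    rw [abs_mul]
    gcongr
    linarith [abs_sub (q * r) (s * t)]
  have h₁ := abs_le.1 (term _ _ _ _ _ _ _ _ ha hb₁ hc₂ hb₂ hc₁)
  have h₂ := abs_le.1 (term _ _ _ _ _ _ _ _ hb ha₁ hc₂ ha₂ hc₁)
  have h₃ := abs_le.1 (term _ _ _ _ _ _ _ _ hc ha₁ hb₂ ha₂ hb₁)
  rw [expand, abs_le]
  constructor <;> linarith [h₁.1, h₁.2, h₂.1, h₂.2, h₃.1, h₃.2]

lemma abs_le_norm4 (x : Fin 4 → ℝ) (i : Fin 4) : |x i| ≤ norm4 x := by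
  fin_cases i <;> simp [norm4]

lemma abs_sub_le_L4 (ξ : ℝ) (x : Fin 4 → ℝ) :
    |x 0 * ξ - x 1| ≤ L4 ξ x ∧ |x 0 * ξ ^ 2 - x 2| ≤ L4 ξ x ∧ |x 0 * ξ ^ 3 - x 3| ≤ L4 ξ x := by
  simp [L4]

lemma L4_nonneg (ξ : ℝ) (x : Fin 4 → ℝ) : 0 ≤ L4 ξ x :=
  (abs_nonneg _).trans (abs_sub_le_L4 ξ x).1

lemma norm4_nonneg (x : Fin 4 → ℝ) : 0 ≤ norm4 x :=
  (abs_nonneg _).trans (abs_le_norm4 x 0)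

/-- A constant dominating the coefficients that occur when comparing `x⁻`, `x⁺` and
`ξ x⁻ - x⁺` with `L(x)` and `‖x‖`. -/
def comparisonConst (ξ : ℝ) : ℝ := 1 + 2 * |ξ| + |ξ| ^ 2 + |ξ| ^ 3

lemma one_le_comparisonConst (ξ : ℝ) : 1 ≤ comparisonConst ξ := by
  have : 0 ≤ 2 * |ξ| + |ξ| ^ 2 + |ξ| ^ 3 := by positivity
  unfold comparisonConst
  linarith

lemma abs_combination_le (ξ c₀ c₁ c₂ u v w K : ℝ) (hu : |u| ≤ K) (hv : |v| ≤ K) (hw : |w| ≤ K)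
    (hc : |c₀| + |c₁| + |c₂| ≤ comparisonConst ξ) :
    |c₀ * u + c₁ * v + c₂ * w| ≤ comparisonConst ξ * K := by
  have hK : 0 ≤ K := (abs_nonneg u).trans hu
  calc |c₀ * u + c₁ * v + c₂ * w| ≤ |c₀| * |u| + |c₁| * |v| + |c₂| * |w| := by
        simpa only [abs_mul] using abs_add_three (c₀ * u) (c₁ * v) (c₂ * w)
    _ ≤ |c₀| * K + |c₁| * K + |c₂| * K := by gcongr
    _ = (|c₀| + |c₁| + |c₂|) * K := by ring
    _ ≤ comparisonConst ξ * K := by gcongr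

/-- A combination of the deviations of `x` from `x₀ (1, ξ, ξ², ξ³)` is controlled by `L(x)`. -/
lemma abs_deviation_le (ξ : ℝ) (x : Fin 4 → ℝ) (c₁ c₂ c₃ d : ℝ)
    (hd : d = c₁ * (x 0 * ξ - x 1) + c₂ * (x 0 * ξ ^ 2 - x 2) + c₃ * (x 0 * ξ ^ 3 - x 3))
    (hc : |c₁| + |c₂| + |c₃| ≤ comparisonConst ξ) :
    |d| ≤ comparisonConst ξ * L4 ξ x := by
  obtain ⟨h₁, h₂, h₃⟩ := abs_sub_le_L4 ξ x
  rw [hd]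
  exact abs_combination_le ξ _ _ _ _ _ _ _ h₁ h₂ h₃ hc

lemma L4_le_norm4 (ξ : ℝ) (x : Fin 4 → ℝ) : L4 ξ x ≤ comparisonConst ξ * norm4 x := by
  have key (c : ℝ) (i : Fin 4) (hc : |c| + 1 ≤ comparisonConst ξ) :
      |x 0 * c - x i| ≤ comparisonConst ξ * norm4 x := by
    have h := abs_combination_le ξ c (-1) 0 _ _ _ _ (abs_le_norm4 x 0) (abs_le_norm4 x i)
      (abs_le_norm4 x i) (by simpa using hc)
    convert h using 2
    ring
  have h₁ := abs_nonneg ξ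
  have h₂ := pow_nonneg h₁ 2
  have h₃ := pow_nonneg h₁ 3
  refine max_le (max_le (key _ _ ?_) (key _ _ ?_)) (key _ _ ?_) <;>
    simp only [abs_pow, comparisonConst] <;> linarith

lemma abs_vm_deviation_le (ξ : ℝ) (x : Fin 4 → ℝ) :
    |vm x 0 * ξ - vm x 1| ≤ comparisonConst ξ * L4 ξ x ∧
      |vm x 0 * ξ ^ 2 - vm x 2| ≤ comparisonConst ξ * L4 ξ x := by
  have h := one_le_comparisonConst ξ
  constructor
  · exact abs_deviation_le ξ x 1 0 0 _ (by simp [vm]) (by simpa using h)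
  · exact abs_deviation_le ξ x 0 1 0 _ (by simp [vm]) (by simpa using h)

lemma abs_vp_deviation_le (ξ : ℝ) (x : Fin 4 → ℝ) :
    |vp x 0 * ξ - vp x 1| ≤ comparisonConst ξ * L4 ξ x ∧
      |vp x 0 * ξ ^ 2 - vp x 2| ≤ comparisonConst ξ * L4 ξ x := by
  have h₁ := abs_nonneg ξ
  have h₂ := pow_nonneg h₁ 2
  have h₃ := pow_nonneg h₁ 3
  constructor
  · refine abs_deviation_le ξ x (-ξ) 1 0 _ (by simp [vp]; ring) ?_
    simp only [abs_neg, abs_one, abs_zero, comparisonConst]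
    linarith
  · refine abs_deviation_le ξ x (-ξ ^ 2) 0 1 _ (by simp [vp]; ring) ?_
    simp only [abs_neg, abs_pow, abs_one, abs_zero, comparisonConst]
    linarith

lemma abs_smul_vm_sub_vp_deviation_le (ξ : ℝ) (x : Fin 4 → ℝ) :
    |(ξ • vm x - vp x) 0 * ξ - (ξ • vm x - vp x) 1| ≤ comparisonConst ξ * L4 ξ x ∧
      |(ξ • vm x - vp x) 0 * ξ ^ 2 - (ξ • vm x - vp x) 2| ≤ comparisonConst ξ * L4 ξ x := by
  have h₁ := abs_nonneg ξ
  have h₂ := pow_nonneg h₁ 2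
  have h₃ := pow_nonneg h₁ 3
  constructor
  · refine abs_deviation_le ξ x (2 * ξ) (-1) 0 _ (by simp [vm, vp]; ring) ?_
    simp only [abs_neg, abs_mul, abs_two, abs_one, abs_zero, comparisonConst]
    linarith
  · refine abs_deviation_le ξ x (ξ ^ 2) ξ (-1) _ (by simp [vm, vp]; ring) ?_
    simp only [abs_neg, abs_pow, abs_one, comparisonConst]
    linarith

lemma Cmap_mul_sub (ξ : ℝ) (x y : Fin 4 → ℝ) :
    Cmap x y 0 * ξ - Cmap x y 1 = det3 (vm x) (vp x) (ξ • vm y - vp y) := by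
  simp [Cmap, det3, Matrix.det_fin_three]
  ring

theorem statement8 (ξ : ℝ) :
    ∃ κ : ℝ, 0 < κ ∧ ∀ x y : Fin 4 → ℝ,
      max |Cmap x y 0| |Cmap x y 1|
        ≤ κ * (norm4 x * L4 ξ x * L4 ξ y + norm4 y * L4 ξ x ^ 2) ∧
      |Cmap x y 0 * ξ - Cmap x y 1| ≤ κ * (norm4 x * L4 ξ x * L4 ξ y) := by
  have hM := one_le_comparisonConst ξ
  set M := comparisonConst ξ
  have hM₀ : 0 < M := by linarith
  refine ⟨4 * M ^ 2 + 2 * M ^ 3, by positivity, fun x y => ?_⟩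
  have hLx := L4_nonneg ξ x
  have hLy := L4_nonneg ξ y
  have hNx := norm4_nonneg x
  have hNy := norm4_nonneg y
  obtain ⟨hm₁, hm₂⟩ := abs_vm_deviation_le ξ x
  obtain ⟨hp₁, hp₂⟩ := abs_vp_deviation_le ξ x
  have bound (P : ℝ) (c : Fin 3 → ℝ) (hc : |c 0| ≤ P)
      (h : |c 0 * ξ - c 1| ≤ M * L4 ξ y ∧ |c 0 * ξ ^ 2 - c 2| ≤ M * L4 ξ y) :
      |det3 (vm x) (vp x) c| ≤
        4 * (norm4 x * (M * L4 ξ x) * (M * L4 ξ y)) + 2 * (P * (M * L4 ξ x) ^ 2) :=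
    abs_det3_le ξ _ _ _ _ _ _ _ (abs_le_norm4 x 0) (abs_le_norm4 x 1) hc hm₁ hm₂ hp₁ hp₂ h.1 h.2
  constructor
  · have absorb : 4 * (norm4 x * (M * L4 ξ x) * (M * L4 ξ y))
          + 2 * (norm4 y * (M * L4 ξ x) ^ 2) ≤
        (4 * M ^ 2 + 2 * M ^ 3) * (norm4 x * L4 ξ x * L4 ξ y + norm4 y * L4 ξ x ^ 2) := by
      have h₁ : 0 ≤ 2 * M ^ 3 * (norm4 x * L4 ξ x * L4 ξ y) := by positivity
      have h₂ : 0 ≤ (2 * M ^ 2 + 2 * M ^ 3) * (norm4 y * L4 ξ x ^ 2) := by positivity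
      linarith
    exact max_le ((bound _ _ (abs_le_norm4 y 0) (abs_vm_deviation_le ξ y)).trans absorb)
      ((bound _ _ (abs_le_norm4 y 1) (abs_vp_deviation_le ξ y)).trans absorb)
  · rw [Cmap_mul_sub]
    have hc : |(ξ • vm y - vp y) 0| ≤ L4 ξ y := by
      simpa [vm, vp, mul_comm] using (abs_sub_le_L4 ξ y).1
    have h := bound _ _ hc (abs_smul_vm_sub_vp_deviation_le ξ y)
    have hL : 2 * M ^ 2 * L4 ξ y * L4 ξ x * L4 ξ x ≤
        2 * M ^ 2 * L4 ξ y * L4 ξ x * (M * norm4 x) :=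
      mul_le_mul_of_nonneg_left (L4_le_norm4 ξ x) (by positivity)
    linarith
end
end
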